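/- Let X ⊂ ℙ^r be an integral and non-degenerate projective variety of dimension n over an algebraically closed field of characteristic 0. Let k be a positive integer such that X is weakly k-defective and dim σ_{k+n−1}(X) = (k+n−1)(n+1)−1 < r. Let A be a general set of k points of X, let Γ_k(A) be the tangential k-contact locus, and let Q be a general point of ⟨A⟩. Then every subset B ⊂ X of cardinality k with Q ∈ ⟨B⟩ is contained in the linear span ⟨Γ_k(A)⟩. -/

import Mathlib

noncomputable section

namespace ContactLoci

variable {K : Type*} [Field K] {ι : Type*} [Fintype ι]

/-- Projective space over `K` with homogeneous coordinates indexed by `ι`. -/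
abbrev PP (K : Type*) [Field K] (ι : Type*) : Type _ :=
  Projectivization K (ι → K)

/-- The affine cone over a set of projective points. -/
def coneOf (S : Set (PP K ι)) : Set (ι → K) :=
  ⋃ x ∈ S, (x.submodule : Set (ι → K))

/-- The linear span, in the underlying vector space, of the cone over `S`. -/
def vspan (S : Set (PP K ι)) : Submodule K (ι → K) :=
  Submodule.span K (coneOf S)

/-- The projective linear span of a set of projective points. -/
def projSpan (S : Set (PP K ι)) : Set (PP K ι) :=
  {x | x.submodule ≤ vspan S}

/-- The projective dimension of the linear span of `S` (`-1` for `S = ∅`). -/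
def projDim (S : Set (PP K ι)) : ℤ :=
  (Module.finrank K (vspan S) : ℤ) - 1

/-- A set of projective points is non-degenerate if its linear span is everything. -/
def Nondegenerate (S : Set (PP K ι)) : Prop :=
  vspan S = ⊤

/-- The common zero locus in projective space of a set of polynomials. -/
def zeroLocus (S : Set (MvPolynomial ι K)) : Set (PP K ι) :=
  {x | ∀ f ∈ S, ∀ v ∈ x.submodule, MvPolynomial.eval v f = 0}

/-- Zariski-closed subsets of projective space: common zero loci of sets of
homogeneous polynomials. -/
def IsZClosed (X : Set (PP K ι)) : Prop :=
  ∃ S : Set (MvPolynomial ι K), (∀ f ∈ S, ∃ d : ℕ, f.IsHomogeneous d) ∧ X = zeroLocus S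

/-- Zariski closure. -/
def zclosure (S : Set (PP K ι)) : Set (PP K ι) :=
  ⋂₀ {Y | IsZClosed Y ∧ S ⊆ Y}

/-- Irreducibility with respect to the Zariski topology. -/
def IsZIrreducible (S : Set (PP K ι)) : Prop :=
  S.Nonempty ∧ ∀ Y Z : Set (PP K ι), IsZClosed Y → IsZClosed Z → S ⊆ Y ∪ Z → S ⊆ Y ∨ S ⊆ Z

/-- An integral projective variety: a Zariski-closed irreducible subset. -/
def IsIntegralVariety (X : Set (PP K ι)) : Prop :=
  IsZClosed X ∧ IsZIrreducible X

/-- `C` is an irreducible component of `S`: a maximal irreducible subset of `S`. -/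
def IsZIrredComponent (S C : Set (PP K ι)) : Prop :=
  IsZIrreducible C ∧ C ⊆ S ∧ ∀ D : Set (PP K ι), IsZIrreducible D → D ⊆ S → C ⊆ D → C = D

/-- The dimension of a set: the Krull dimension of the poset of irreducible
Zariski-closed subsets of its Zariski closure (`⊥` for the empty set). -/
def zdim (S : Set (PP K ι)) : WithBot ℕ∞ :=
  Order.krullDim ({Y : Set (PP K ι) // IsZClosed Y ∧ IsZIrreducible Y ∧ Y ⊆ zclosure S})

/-- A property holds at a general point of `X`: it holds away from a proper
Zariski-closed subset. -/
def HoldsGenerically (X : Set (PP K ι)) (P : PP K ι → Prop) : Prop :=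
  ∃ Y : Set (PP K ι), IsZClosed Y ∧ ¬X ⊆ Y ∧ ∀ x ∈ X \ Y, P x

/-- Zero locus of multihomogeneous polynomials in a self-product of projective space. -/
def multiZeroLocus {m : ℕ} (S : Set (MvPolynomial (Fin m × ι) K)) :
    Set (Fin m → PP K ι) :=
  {u | ∀ f ∈ S, ∀ v : Fin m → ι → K, (∀ i, v i ∈ (u i).submodule) →
    MvPolynomial.eval (fun p => v p.1 p.2) f = 0}

/-- Zariski-closed subsets of the `m`-fold self-product of projective space. -/
def IsMultiZClosed {m : ℕ} (T : Set (Fin m → PP K ι)) : Prop :=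
  ∃ S : Set (MvPolynomial (Fin m × ι) K),
    (∀ f ∈ S, ∀ i : Fin m, ∃ d : ℕ,
      MvPolynomial.IsWeightedHomogeneous (fun p : Fin m × ι => if p.1 = i then 1 else 0) f d) ∧
    T = multiZeroLocus S

/-- A property holds for a general `m`-tuple of points of `X`. -/
def HoldsForGeneralTuples (X : Set (PP K ι)) (m : ℕ) (P : (Fin m → PP K ι) → Prop) : Prop :=
  ∃ T : Set (Fin m → PP K ι), IsMultiZClosed T ∧
    (∃ u : Fin m → PP K ι, (∀ i, u i ∈ X) ∧ u ∉ T) ∧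
    ∀ u : Fin m → PP K ι, (∀ i, u i ∈ X) → u ∉ T → P u

/-- The homogeneous vanishing ideal of `X` (as a set of homogeneous polynomials). -/
def homogVanishingIdeal (X : Set (PP K ι)) : Set (MvPolynomial ι K) :=
  {f | (∃ d : ℕ, f.IsHomogeneous d) ∧ ∀ x ∈ X, ∀ v ∈ x.submodule, MvPolynomial.eval v f = 0}

/-- The embedded (projective) tangent space of `X` at `x`. -/
def embTangentSpace (X : Set (PP K ι)) (x : PP K ι) : Set (PP K ι) :=
  {y | ∀ f ∈ homogVanishingIdeal X,
    ∑ i : ι, y.rep i * MvPolynomial.eval x.rep (MvPolynomial.pderiv i f) = 0}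

/-- Smooth points of `X`. -/
def IsSmoothPoint (X : Set (PP K ι)) (x : PP K ι) : Prop :=
  x ∈ X ∧ zdim (embTangentSpace X x) = zdim X

/-- `M_A`: the linear span of the tangent spaces of `X` at the points of `A`. -/
def tangentSpan (X A : Set (PP K ι)) : Set (PP K ι) :=
  projSpan (⋃ a ∈ A, embTangentSpace X a)

/-- The locus of smooth points of `X` at which `M_A` is tangent to `X`. -/
def tangencyLocus (X A : Set (PP K ι)) : Set (PP K ι) :=
  {x | IsSmoothPoint X x ∧ embTangentSpace X x ⊆ tangentSpan X A}

/-- The tangential contact locus of `X` at `A`: the closure of the union of the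
irreducible components of the tangency locus meeting `A`. -/
def contactLocus (X A : Set (PP K ι)) : Set (PP K ι) :=
  zclosure (⋃ C ∈ {C : Set (PP K ι) |
    IsZIrredComponent (tangencyLocus X A) C ∧ (C ∩ A).Nonempty}, C)

/-- `X` is weakly `k`-defective: the tangential contact locus at `k` general points
has positive dimension. -/
def WeaklyDefective (X : Set (PP K ι)) (k : ℕ) : Prop :=
  HoldsForGeneralTuples X k fun u => 0 < zdim (contactLocus X (Set.range u))

/-- The `k`-th secant variety of `X`. -/
def secant (k : ℕ) (X : Set (PP K ι)) : Set (PP K ι) :=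
  zclosure {q | ∃ S : Finset (PP K ι), ↑S ⊆ X ∧ S.card = k ∧ q ∈ projSpan (S : Set (PP K ι))}

/-- The `X`-rank of a point. -/
def xrank (X : Set (PP K ι)) (q : PP K ι) : ℕ :=
  sInf {k | ∃ S : Finset (PP K ι), ↑S ⊆ X ∧ S.card = k ∧ q ∈ projSpan (S : Set (PP K ι))}

/-- `𝒮(q,X)`: the set of minimal `X`-decompositions of `q`. -/
def decompositions (X : Set (PP K ι)) (q : PP K ι) : Set (Finset (PP K ι)) :=
  {S | ↑S ⊆ X ∧ S.card = xrank X q ∧ q ∈ projSpan (S : Set (PP K ι))}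

/-- `X` is `k`-identifiable: a general point of `σ_k(X)` has a unique minimal
decomposition. -/
def Identifiable (X : Set (PP K ι)) (k : ℕ) : Prop :=
  HoldsGenerically (secant k X) fun q => ∃! S : Finset (PP K ι), S ∈ decompositions X q

/-- `α` is the `k`-th secant degree of `X`. -/
def HasSecantDegree (X : Set (PP K ι)) (k α : ℕ) : Prop :=
  HoldsGenerically (secant k X) fun q => (decompositions X q).ncard = α

/-- Projective linear subspaces. -/
def IsProjLinear (L : Set (PP K ι)) : Prop :=
  L = projSpan L

/-- Lines in projective space. -/
def IsLine (L : Set (PP K ι)) : Prop :=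
  IsProjLinear L ∧ Module.finrank K (vspan L) = 2

/-- `X` is uniruled by lines: through a general point of `X` there is a line
contained in `X`. -/
def UniruledByLines (X : Set (PP K ι)) : Prop :=
  HoldsGenerically X fun x => ∃ L : Set (PP K ι), IsLine L ∧ x ∈ L ∧ L ⊆ X

/-- The join of two sets in projective space. -/
def join (A B : Set (PP K ι)) : Set (PP K ι) :=
  zclosure (⋃ a ∈ A, ⋃ b ∈ B, projSpan {a, b})

/-- The linear space `M` is tangent to `X` along `W`. -/
def TangentAlong (M X W : Set (PP K ι)) : Prop :=
  ∀ x ∈ W, IsSmoothPoint X x → embTangentSpace X x ⊆ M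

/-- `S` has exactly `m` irreducible components, all of them projective linear
subspaces, and these components are linearly independent. -/
def ComponentsAreIndepLinear (S : Set (PP K ι)) (m : ℕ) : Prop :=
  ∃ C : Fin m → Set (PP K ι), Function.Injective C ∧
    (∀ D : Set (PP K ι), IsZIrredComponent S D ↔ ∃ i, D = C i) ∧
    (∀ i, IsProjLinear (C i)) ∧
    Module.finrank K (vspan S) = ∑ i, Module.finrank K (vspan (C i))


/-- The Segre variety: the image of `ℙ^{n 1} × ⋯ × ℙ^{n s}` under the Segre
embedding, given by the complete linear system `|O(1,…,1)|`. -/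
def segreVariety (K : Type*) [Field K] (s : ℕ) (n : Fin s → ℕ) :
    Set (PP K (∀ i : Fin s, Fin (n i + 1))) :=
  {x | ∃ u : ∀ i : Fin s, Fin (n i + 1) → K,
    x.submodule = Submodule.span K
      ({fun t => ∏ i, u i (t i)} : Set ((∀ i : Fin s, Fin (n i + 1)) → K))}

/-- The projection of `L ⊆ Segre` to the `i`-th factor is a single point, i.e. `L`
lies in a single fiber of the `i`-th projection. -/
def SegreFactorIsPoint (K : Type*) [Field K] (s : ℕ) (n : Fin s → ℕ) (i : Fin s)
    (L : Set (PP K (∀ j : Fin s, Fin (n j + 1)))) : Prop :=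
  ∃ w : Fin (n i + 1) → K, w ≠ 0 ∧ ∀ x ∈ L,
    ∃ u : ∀ j : Fin s, Fin (n j + 1) → K,
      x.submodule = Submodule.span K
        ({fun t => ∏ j, u j (t j)} : Set ((∀ j : Fin s, Fin (n j + 1)) → K)) ∧
      u i ∈ Submodule.span K ({w} : Set (Fin (n i + 1) → K))

/-- Index type for the Segre–Veronese embedding of multidegree `d`:
multi-indices of degree `d i` in the homogeneous variables of the `i`-th factor. -/
abbrev svIndex (s : ℕ) (n d : Fin s → ℕ) : Type :=
  ∀ i : Fin s, {w : Fin (n i + 1) → Fin (d i + 1) // ∑ j, (w j : ℕ) = d i}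

/-- The Segre–Veronese variety of multidegree `d`: the image of
`ℙ^{n 1} × ⋯ × ℙ^{n s}` under the embedding by `|L_1^{d 1} ⊗ ⋯ ⊗ L_s^{d s}|`. -/
def segreVeroneseVariety (K : Type*) [Field K] (s : ℕ) (n d : Fin s → ℕ) :
    Set (PP K (svIndex s n d)) :=
  {x | ∃ u : ∀ i : Fin s, Fin (n i + 1) → K,
    x.submodule = Submodule.span K
      ({fun t => ∏ i, ∏ j, u i j ^ ((t i).1 j : ℕ)} : Set (svIndex s n d → K))}

/-- The vector of the moments of degree `≤ d` of the one-dimensional Gaussian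
distribution with mean `μ` and variance `t`. -/
def gaussMomentVec (K : Type*) [Field K] (d : ℕ) (μ t : K) : Fin (d + 1) → K := fun i =>
  ∑ j ∈ Finset.range ((i : ℕ) / 2 + 1),
    ((Nat.choose (i : ℕ) (2 * j) * Nat.doubleFactorial (2 * j - 1) : ℕ) : K) *
      t ^ j * μ ^ ((i : ℕ) - 2 * j)

/-- The Gaussian moment variety `𝒢_{1,d} ⊆ ℙ^d`. -/
def gaussianMomentVariety (K : Type*) [Field K] (d : ℕ) : Set (PP K (Fin (d + 1))) :=
  zclosure {x | ∃ μ t : K,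
    x.submodule = Submodule.span K ({gaussMomentVec K d μ t} : Set (Fin (d + 1) → K))}

/-- Zariski-closed families of `m`-tuples of coefficient vectors of linear forms. -/
def IsAffineClosedFamily {m : ℕ} (T : Set (Fin m → ι → K)) : Prop :=
  ∃ S : Set (MvPolynomial (Fin m × ι) K),
    T = {h | ∀ f ∈ S, MvPolynomial.eval (fun p => h p.1 p.2) f = 0}

/-- The linear subspace cut out by the `m` linear forms with coefficient vectors `h`. -/
def linearSlice {m : ℕ} (h : Fin m → ι → K) : Set (PP K ι) :=
  {x | ∀ j : Fin m, ∑ i : ι, h j i * x.rep i = 0}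

/-- `x` lies on the hyperplane with coefficient vector `f`. -/
def inHyperplane (f : ι → K) (x : PP K ι) : Prop :=
  ∑ i : ι, f i * x.rep i = 0

/-- `X ⊆ ℙ^r` (of dimension `n`, `r + 1 = card ι`) is very strange: for a general
codimension-`n` linear subspace `M`, some `r - n + 2` points of `X ∩ M` lie in a
hyperplane of `M`, i.e. in a linear subspace of projective dimension `r - n - 1`. -/
def VeryStrange (n : ℕ) (X : Set (PP K ι)) : Prop :=
  ∃ T : Set (Fin n → ι → K), IsAffineClosedFamily T ∧ (∃ h, h ∉ T) ∧
    ∀ h : Fin n → ι → K, h ∉ T →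
      ∃ A : Finset (PP K ι), ↑A ⊆ X ∩ linearSlice h ∧
        A.card = Fintype.card ι + 1 - n ∧
        Module.finrank K (vspan (A : Set (PP K ι))) ≤ Fintype.card ι - 1 - n

section Helpers
set_option linter.all false
set_option linter.style.haveILetI false
set_option linter.unusedSimpArgs false
open MvPolynomial

section FieldTheory

/-- rank of a set in the algebraic matroid -/
abbrev rk (K : Type*) {L : Type*} [Field K] [Field L] [Algebra K L] (S : Set L) : ℕ∞ :=
  (AlgebraicIndependent.matroid K L).eRk S

theorem algIndep_of_ker {K L L' σ : Type*} [Field K] [Field L] [Field L']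
    [Algebra K L] [Algebra K L'] (v : σ → L) (v' : σ → L')
    (h : ∀ p : MvPolynomial σ K, aeval v p = 0 → aeval v' p = 0)
    {τ : Type*} (g : τ → σ) (hi : AlgebraicIndependent K (v' ∘ g)) :
    AlgebraicIndependent K (v ∘ g) := by
  rw [algebraicIndependent_iff] at hi ⊢
  intro p hp
  apply hi
  have := h (rename g p) (by rw [aeval_rename]; exact hp)
  rwa [aeval_rename] at this

theorem exists_basis_index {K L σ : Type*} [Field K] [Field L] [Algebra K L] (v : σ → L) :
    ∃ b : Set σ, AlgebraicIndependent K (fun i : b => v i) ∧ rk K (Set.range v) = b.encard := by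
  obtain ⟨I, hI⟩ := (AlgebraicIndependent.matroid K L).exists_isBasis (Set.range v)
  have hIr : I ⊆ Set.range v := hI.subset
  obtain ⟨b, hb, hbi⟩ := (Set.subset_range_iff_exists_image_eq).1 hIr |>.imp fun b hb => (⟨hb, trivial⟩ : v '' b = I ∧ True)
  obtain ⟨c, hcb, hc, hcinj⟩ := Set.SurjOn.exists_bijOn_subset (s := b) (t := I) (f := v) (by rw [← hb]; exact Set.surjOn_image _ _) |>.imp fun c hc => (⟨hc.1, hc.2, hc.2.injOn⟩ : c ⊆ b ∧ Set.BijOn v c I ∧ Set.InjOn v c)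
  refine ⟨c, ?_, ?_⟩
  · have hind := hI.indep
    rw [AlgebraicIndependent.matroid_indep_iff] at hind
    have h2 : AlgebraicIndependent K (fun i : I => (i : L)) := hind
    exact h2.comp (fun i : c => (⟨v i, hc.mapsTo i.2⟩ : I))
      (fun a b hab => Subtype.ext (hcinj a.2 b.2 (by simpa using hab)))
  · have h3 := hI.encard_eq_eRk
    rw [← hc.image_eq, hcinj.encard_image] at h3
    exact h3.symm

theorem encard_le_rk {K L σ : Type*} [Field K] [Field L] [Algebra K L] (v : σ → L) (b : Set σ)
    (hb : AlgebraicIndependent K (fun i : b => v i)) (S : Set L) (hS : v '' b ⊆ S) :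
    b.encard ≤ rk K S := by
  have hinj : Set.InjOn v b := Set.injOn_iff_injective.2 hb.injective
  rw [← hinj.encard_image]
  refine Matroid.Indep.encard_le_eRk_of_subset ?_ hS
  rw [AlgebraicIndependent.matroid_indep_iff]
  exact AlgebraicIndependent.image_of_comp b v id hb

theorem rk_le_of_ker {K L L' σ : Type*} [Field K] [Field L] [Field L']
    [Algebra K L] [Algebra K L'] (v : σ → L) (v' : σ → L')
    (h : ∀ p : MvPolynomial σ K, aeval v p = 0 → aeval v' p = 0) :
    rk K (Set.range v') ≤ rk K (Set.range v) := by
  obtain ⟨b, hb, hbc⟩ := exists_basis_index (K := K) v'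
  rw [hbc]
  exact encard_le_rk v b (algIndep_of_ker v v' h (Subtype.val : b → σ) hb) _
    (Set.image_subset_range _ _)

theorem mem_closure_iff {K L : Type*} [Field K] [Field L] [Algebra K L] (S : Set L) (x : L) :
    x ∈ (AlgebraicIndependent.matroid K L).closure S ↔ IsAlgebraic (Algebra.adjoin K S) x := by
  rw [AlgebraicIndependent.matroid_closure_eq]; simp [Subalgebra.mem_algebraicClosure]

theorem adjoin_subset_closure {K L : Type*} [Field K] [Field L] [Algebra K L] (S : Set L) (x : L)
    (hx : x ∈ Algebra.adjoin K S) : x ∈ (AlgebraicIndependent.matroid K L).closure S := by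
  rw [mem_closure_iff]
  exact isAlgebraic_algebraMap (⟨x, hx⟩ : Algebra.adjoin K S)

theorem exists_dvd_poly {K L σ τ : Type*} [Field K] [Field L] [Algebra K L] (v : σ → L)
    (g : τ → σ) (p : MvPolynomial σ K) (hp : aeval v p ≠ 0)
    (halg : IsAlgebraic (Algebra.adjoin K (Set.range (v ∘ g))) (aeval v p)) :
    ∃ (pr : MvPolynomial τ K) (ps : MvPolynomial σ K), aeval (v ∘ g) pr ≠ 0 ∧
      aeval v (rename g pr - p * ps) = 0 := by
  obtain ⟨q, hq0, hq⟩ := halg.exists_nonzero_coeff_and_aeval_eq_zero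
    (mem_nonZeroDivisors_of_ne_zero hp)
  have hadj : ∀ z ∈ Algebra.adjoin K (Set.range (v ∘ g)), ∃ t : MvPolynomial τ K,
      aeval (v ∘ g) t = z := by
    intro z hz
    rw [Algebra.adjoin_range_eq_range_aeval] at hz
    exact hz
  obtain ⟨pr, hpr⟩ : ∃ pr : MvPolynomial τ K, aeval (v ∘ g) pr = ((q.coeff 0 : _) : L) := by
    exact hadj _ (q.coeff 0).2
  obtain ⟨ps, hps⟩ : ∃ ps : MvPolynomial σ K, aeval v ps = Polynomial.aeval (aeval v p) q.divX := by
    have hm : ∀ n, ∃ t : MvPolynomial σ K, aeval v t = ((q.divX.coeff n : _) : L) := by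
      intro n
      obtain ⟨t, ht⟩ := hadj _ (q.divX.coeff n).2
      exact ⟨rename g t, by rw [aeval_rename]; exact ht⟩
    choose t ht using hm
    refine ⟨∑ n ∈ Finset.range (q.divX.natDegree + 1), t n * p ^ n, ?_⟩
    rw [Polynomial.aeval_eq_sum_range, map_sum]
    refine Finset.sum_congr rfl fun n _ => ?_
    rw [map_mul, map_pow, ht, Algebra.smul_def]
    rfl
  refine ⟨pr, -ps, ?_, ?_⟩
  · rw [hpr]
    exact fun h => hq0 (Subtype.ext h)
  · have h3 := congrArg (Polynomial.aeval (aeval v p)) (Polynomial.X_mul_divX_add q)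
    rw [hq, map_add, map_mul, Polynomial.aeval_X, Polynomial.aeval_C, ← hps] at h3
    rw [map_sub, map_mul, map_neg, aeval_rename, hpr, mul_neg, sub_neg_eq_add, add_comm]
    exact h3

theorem ker_of_rk_le {K L L' σ : Type*} [Field K] [Field L] [Field L']
    [Algebra K L] [Algebra K L'] (v : σ → L) (v' : σ → L')
    (h : ∀ p : MvPolynomial σ K, aeval v p = 0 → aeval v' p = 0)
    (hfin : rk K (Set.range v') ≠ ⊤) (hle : rk K (Set.range v) ≤ rk K (Set.range v')) :
    ∀ p : MvPolynomial σ K, aeval v' p = 0 → aeval v p = 0 := by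
  obtain ⟨b, hb, hbc⟩ := exists_basis_index (K := K) v'
  have hbf : b.Finite := by rw [← Set.encard_ne_top_iff, ← hbc]; exact hfin
  have hb2 := algIndep_of_ker v v' h (Subtype.val : b → σ) hb
  intro p hp
  by_contra hne
  -- image of b is a basis of range v
  have hcl : aeval v p ∈ (AlgebraicIndependent.matroid K L).closure (v '' b) := by
    have hfin2 : (AlgebraicIndependent.matroid K L).IsRkFinite (v '' b) :=
      Matroid.isRkFinite_of_finite _ (hbf.image v)
    have := hfin2.closure_eq_closure_of_subset_of_eRk_ge_eRk (Set.image_subset_range v b)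
      (hle.trans (by rw [hbc]; exact encard_le_rk v b hb2 _ subset_rfl))
    rw [this]
    apply adjoin_subset_closure
    rw [Algebra.adjoin_range_eq_range_aeval]
    exact ⟨p, rfl⟩
  rw [mem_closure_iff] at hcl
  have hr : v '' b = Set.range (v ∘ (Subtype.val : b → σ)) := by
    rw [Set.range_comp, Subtype.range_val]
  rw [hr] at hcl
  obtain ⟨pr, ps, h1, h2⟩ := exists_dvd_poly v (Subtype.val : b → σ) p hne hcl
  have h3 := h _ h2
  rw [map_sub, map_mul, hp, zero_mul, sub_zero, aeval_rename] at h3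
  have h4 : pr = 0 := (algebraicIndependent_iff.1 hb) pr h3
  exact h1 (by rw [h4, map_zero])

/-- extension of derivations from a transcendence basis, characteristic zero -/
theorem exists_derivation {K L : Type*} [Field K] [CharZero K] [Field L] [Algebra K L]
    {σ : Type*} (y : σ → L) (hy : IsTranscendenceBasis K y) (b : σ → L) :
    ∃ D : Derivation K L L, ∀ i, D (y i) = b i := by
  let R := MvPolynomial σ K
  letI : Algebra R L := (aeval y : R →ₐ[K] L).toAlgebra
  haveI : IsScalarTower K R L := IsScalarTower.of_algebraMap_eq (fun x => by
    exact ((aeval y : MvPolynomial σ K →ₐ[K] L).commutes x).symm)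
  have hinj : Function.Injective (algebraMap R L) := hy.1
  haveI : FaithfulSMul R L := (faithfulSMul_iff_algebraMap_injective R L).2 hinj
  let F := FractionRing R
  letI : Algebra F L := FractionRing.liftAlgebra R L
  haveI : IsScalarTower R F L := inferInstance
  haveI : Algebra.IsAlgebraic R L := by
    refine ⟨fun a => ?_⟩
    have h1 := hy.isAlgebraic.isAlgebraic a
    refine IsAlgebraic.of_ringHom_of_comp_eq (S := Algebra.adjoin K (Set.range y)) (B := L)
      ((hy.1.aevalEquiv : MvPolynomial σ K ≃ₐ[K] _).toRingEquiv : R ≃+* _) (RingEquiv.refl L)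
      h1 (hy.1.aevalEquiv).surjective (RingEquiv.refl L).injective ?_
    refine RingHom.ext fun x => ?_
    exact hy.1.algebraMap_aevalEquiv x
  haveI : Algebra.IsAlgebraic F L := (IsFractionRing.comap_isAlgebraic_iff (A := R)).1 inferInstance
  haveI : CharZero R := inferInstanceAs (CharZero (MvPolynomial σ K))
  haveI : CharZero F := charZero_of_injective_algebraMap (IsFractionRing.injective R F)
  haveI : Algebra.FormallyEtale F L := Algebra.FormallyEtale.of_isSeparable F L
  haveI : Algebra.FormallyEtale R F := Algebra.FormallyEtale.of_isLocalization (nonZeroDivisors R)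
  haveI : Algebra.FormallyEtale R L := Algebra.FormallyEtale.comp R F L
  let D0 : Derivation K R L := mkDerivation K b
  let l : TensorProduct R L (Ω[R⁄K]) →ₗ[L] L := D0.liftKaehlerDifferential.liftBaseChange L
  let l' : Ω[L⁄K] →ₗ[L] L :=
    l.comp (KaehlerDifferential.tensorKaehlerEquivOfFormallyEtale K R L).symm.toLinearMap
  refine ⟨l'.compDer (KaehlerDifferential.D K L), fun i => ?_⟩
  have h1 : y i = algebraMap R L (X i) := by
    change y i = aeval y (X i); simp
  rw [h1]
  change l ((KaehlerDifferential.tensorKaehlerEquivOfFormallyEtale K R L).symm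
    (KaehlerDifferential.D K L (algebraMap R L (X i)))) = b i
  rw [KaehlerDifferential.tensorKaehlerEquivOfFormallyEtale_symm_D_algebraMap]
  simp only [l, D0, LinearMap.liftBaseChange_tmul, one_smul,
    Derivation.liftKaehlerDifferential_comp_D]
  exact mkDerivation_X _ _ _

theorem derivation_eq_zero {K L : Type*} [Field K] [CharZero K] [Field L] [Algebra K L]
    (S : Set L) (hS : (AlgebraicIndependent.matroid K L).closure S = Set.univ)
    (D : Derivation K L L) (hD : ∀ x ∈ S, D x = 0) : D = 0 := by
  ext a
  have ha : IsAlgebraic (Algebra.adjoin K S) a := by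
    rw [← mem_closure_iff, hS]; trivial
  have hE : ∀ x ∈ Algebra.adjoin K S, D x = 0 := by
    intro x hx
    induction hx using Algebra.adjoin_induction with
    | mem x hx => exact hD x hx
    | algebraMap r => simp
    | add x y _ _ h1 h2 => simp [h1, h2]
    | mul x y _ _ h1 h2 => simp [h1, h2]
  let D' : Derivation (Algebra.adjoin K S) L L := Derivation.mk'
    { toFun := D, map_add' := D.map_add, map_smul' := fun r x => by
        rw [Algebra.smul_def, D.leibniz]
        have := hE r r.2
        change (r : L) • D x + x • D (r : L) = _
        rw [this]; simp [Algebra.smul_def] } (fun a b => D.leibniz a b)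
  have key : ∀ m : ℕ, ∀ P : Polynomial (Algebra.adjoin K S), P.natDegree ≤ m → P ≠ 0 →
      Polynomial.aeval a P = 0 → D' a = 0 := by
    intro m
    induction m with
    | zero =>
      intro P hP h0 hPa
      rw [Polynomial.eq_C_of_natDegree_le_zero hP] at hPa h0
      rw [Polynomial.aeval_C] at hPa
      exact absurd (Subtype.ext hPa : P.coeff 0 = 0) (fun h => h0 (by rw [h, map_zero]))
    | succ m ih =>
      intro P hP h0 hPa
      by_cases hd : Polynomial.aeval a (Polynomial.derivative P) = 0
      · by_cases hdz : P.natDegree = 0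
        · exact ih P (by omega) h0 hPa
        · refine ih _ ?_ ?_ hd
          · have := Polynomial.natDegree_derivative_lt hdz
            omega
          · intro hz
            haveI : CharZero (Algebra.adjoin K S) :=
              charZero_of_injective_algebraMap (algebraMap K (Algebra.adjoin K S)).injective
            exact hdz (Polynomial.natDegree_eq_zero_of_derivative_eq_zero hz)
      · have h1 := D'.map_aeval P a
        rw [hPa, map_zero, smul_eq_mul] at h1
        exact (mul_eq_zero.1 h1.symm).resolve_left hd
  obtain ⟨P, hP0, hPa⟩ := ha
  exact key _ P le_rfl hP0 hPa

theorem rank_derivation {K L : Type*} [Field K] [CharZero K] [Field L] [Algebra K L]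
    {V : Type*} [AddCommGroup V] [Module L V] [FiniteDimensional L V] (m : ℕ)
    (hm : (m : ℕ∞) ≤ rk K (Set.univ : Set L)) (Φ : Derivation K L L →ₗ[L] V)
    (hΦ : Function.Injective Φ) :
    m ≤ Module.finrank L V ∧ (Module.finrank L V ≤ m → Function.Surjective Φ) := by
  haveI : FiniteDimensional L (Derivation K L L) := FiniteDimensional.of_injective Φ hΦ
  have h1 : m ≤ Module.finrank L (Derivation K L L) := by
    obtain ⟨B, hB⟩ := (AlgebraicIndependent.matroid K L).exists_isBase
    have hBt := (AlgebraicIndependent.matroid_isBase_iff).1 hB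
    classical
    choose D hD using fun i : B => exists_derivation (fun j : B => (j : L)) hBt (Pi.single i 1)
    have hli : LinearIndependent L D := by
      rw [linearIndependent_iff']
      intro s g hg i hi
      have := congrArg (fun E : Derivation K L L => E (i : L)) hg
      have hs : ∀ E : B → Derivation K L L, (∑ j ∈ s, E j) (i : L) = ∑ j ∈ s, E j (i:L) := fun E => by
        have := congrFun (map_sum (Derivation.coeFnAddMonoidHom (R := K) (A := L) (M := L)) E s) (i : L)
        rw [Finset.sum_apply] at this
        exact this
      simp only [hs, Derivation.smul_apply, hD, Derivation.zero_apply] at this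
      simpa [Pi.single_apply, hi] using this
    have hfin : Finite B := hli.finite
    haveI := Fintype.ofFinite B
    have h2 := hli.fintype_card_le_finrank
    have h3 : B.encard = rk K (Set.univ : Set L) := by
      rw [hB.encard_eq_eRank, ← Matroid.eRk_univ_eq]
    rw [← h3, Set.encard_eq_coe_toFinset_card, Set.toFinset_card] at hm
    exact (by exact_mod_cast hm : m ≤ Fintype.card B).trans h2
  have h2 := LinearMap.finrank_le_finrank_of_injective hΦ
  refine ⟨h1.trans h2, fun h3 => ?_⟩
  exact (LinearMap.injective_iff_surjective_of_finrank_eq_finrank (le_antisymm h2 (h3.trans h1))).1 hΦ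

end FieldTheory

section Basics
variable {K : Type*} [Field K] {ι : Type*}

/-- vanishing ideal of a set of vectors -/
def VI {σ : Type*} (S : Set (σ → K)) : Ideal (MvPolynomial σ K) where
  carrier := {f | ∀ v ∈ S, eval v f = 0}
  add_mem' := fun ha hb v hv => by rw [map_add, ha v hv, hb v hv, add_zero]
  zero_mem' := fun v _ => map_zero _
  smul_mem' := fun c f hf v hv => by rw [smul_eq_mul, map_mul, hf v hv, mul_zero]

theorem mem_VI {σ : Type*} {S : Set (σ → K)} {f : MvPolynomial σ K} :
    f ∈ VI S ↔ ∀ v ∈ S, eval v f = 0 := Iff.rfl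

theorem rep_mem (x : PP K ι) : x.rep ∈ x.submodule := by
  rw [Projectivization.submodule_eq]; exact Submodule.mem_span_singleton_self _

theorem mem_submodule_iff {x : PP K ι} {v : ι → K} : v ∈ x.submodule ↔ ∃ c : K, v = c • x.rep := by
  rw [Projectivization.submodule_eq, Submodule.mem_span_singleton]
  exact ⟨fun ⟨c, h⟩ => ⟨c, h.symm⟩, fun ⟨c, h⟩ => ⟨c, h.symm⟩⟩

theorem mem_submodule_mk {v : ι → K} (hv : v ≠ 0) : v ∈ (Projectivization.mk K v hv).submodule := by
  rw [Projectivization.submodule_mk]; exact Submodule.mem_span_singleton_self _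

theorem submodule_le_iff {x : PP K ι} {v : ι → K} (hv : v ≠ 0) (hx : v ∈ x.submodule)
    (V : Submodule K (ι → K)) : x.submodule ≤ V ↔ v ∈ V := by
  refine ⟨fun h => h hx, fun h w hw => ?_⟩
  obtain ⟨c, rfl⟩ := mem_submodule_iff.1 hx
  obtain ⟨d, rfl⟩ := mem_submodule_iff.1 hw
  have hc : c ≠ 0 := fun h => hv (by rw [h, zero_smul])
  have := V.smul_mem (d * c⁻¹) h
  rwa [smul_smul, mul_assoc, inv_mul_cancel₀ hc, mul_one] at this

theorem eq_of_mem_submodule {x y : PP K ι} {v : ι → K} (hv : v ≠ 0) (hx : v ∈ x.submodule)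
    (hy : v ∈ y.submodule) : x = y := by
  apply Projectivization.submodule_injective
  exact le_antisymm ((submodule_le_iff hv hx _).2 hy) ((submodule_le_iff hv hy _).2 hx)

theorem mem_coneOf {S : Set (PP K ι)} {v : ι → K} : v ∈ coneOf S ↔ ∃ x ∈ S, v ∈ x.submodule := by
  simp [coneOf]

theorem coneOf_mono {S T : Set (PP K ι)} (h : S ⊆ T) : coneOf S ⊆ coneOf T := by
  intro v hv
  obtain ⟨x, hx, hv⟩ := mem_coneOf.1 hv
  exact mem_coneOf.2 ⟨x, h hx, hv⟩

theorem smul_mem_coneOf {S : Set (PP K ι)} {v : ι → K} (hv : v ∈ coneOf S) (c : K) :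
    c • v ∈ coneOf S := by
  obtain ⟨x, hx, hv⟩ := mem_coneOf.1 hv
  exact mem_coneOf.2 ⟨x, hx, x.submodule.smul_mem c hv⟩

/-- restriction to an affine line -/
def onLine {σ : Type*} (f : MvPolynomial σ K) (v w : σ → K) : Polynomial K :=
  aeval (fun i => Polynomial.C (v i) + Polynomial.X * Polynomial.C (w i)) f

theorem onLine_eval {σ : Type*} (f : MvPolynomial σ K) (v w : σ → K) (t : K) :
    (onLine f v w).eval t = eval (v + t • w) f := by
  have h : (Polynomial.evalRingHom t).comp
      (aeval (fun i => Polynomial.C (v i) + Polynomial.X * Polynomial.C (w i)) :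
        MvPolynomial σ K →ₐ[K] Polynomial K).toRingHom = eval (v + t • w) := by
    refine MvPolynomial.ringHom_ext (fun r => ?_) (fun i => ?_)
    · simp
    · simp; ring
  exact RingHom.congr_fun h f

theorem exists_ne_of_lines {σ : Type*} [Infinite K] (V : Set (σ → K))
    (hV : ∀ v ∈ V, ∀ w ∈ V, ∀ t : K, v + t • (w - v) ∈ V) (f g : MvPolynomial σ K)
    (hf : f ∉ VI V) (hg : g ∉ VI V) : f * g ∉ VI V := by
  simp only [mem_VI, not_forall] at hf hg ⊢
  obtain ⟨v, hv, hfv⟩ := hf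
  obtain ⟨w, hw, hgw⟩ := hg
  by_contra hcon
  push Not at hcon
  have h0 : onLine f v (w - v) * onLine g v (w - v) = 0 := by
    apply Polynomial.funext
    intro t
    rw [Polynomial.eval_mul, onLine_eval, onLine_eval, ← map_mul, Polynomial.eval_zero]
    exact hcon _ (hV v hv w hw t)
  rcases mul_eq_zero.1 h0 with h | h
  · apply hfv
    have := onLine_eval f v (w - v) 0
    rw [h, Polynomial.eval_zero, zero_smul, add_zero] at this
    exact this.symm
  · apply hgw
    have := onLine_eval g v (w - v) 1
    rw [h, Polynomial.eval_zero, one_smul, add_sub_cancel] at this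
    exact this.symm

theorem eval_smul_hom {σ : Type*} (f : MvPolynomial σ K) (v : σ → K) (t : K) :
    eval (t • v) f = ∑ d ∈ Finset.range (f.totalDegree + 1),
      t ^ d * eval v (homogeneousComponent d f) := by
  conv_lhs => rw [← sum_homogeneousComponent f, map_sum]
  refine Finset.sum_congr rfl fun d _ => ?_
  have := (homogeneousComponent_isHomogeneous d f)
  rw [eval_eq, eval_eq, Finset.mul_sum]
  refine Finset.sum_congr rfl fun m hm => ?_
  have hd := this (mem_support_iff.1 hm)
  simp only [Pi.smul_apply, smul_eq_mul, mul_pow, Finset.prod_mul_distrib]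
  rw [Finset.prod_pow_eq_pow_sum]
  have : ∑ i ∈ m.support, m i = d := by
    rw [← hd]; simp [Finsupp.weight_apply, Finsupp.sum]
  rw [this]; ring

theorem line_vanish {σ : Type*} [Infinite K] (f : MvPolynomial σ K) (v : σ → K)
    (h : ∀ t : K, eval (t • v) f = 0) (d : ℕ) : eval v (homogeneousComponent d f) = 0 := by
  have h0 : (∑ d ∈ Finset.range (f.totalDegree + 1),
      Polynomial.C (eval v (homogeneousComponent d f)) * Polynomial.X ^ d : Polynomial K) = 0 := by
    apply Polynomial.funext
    intro t
    rw [Polynomial.eval_finsetSum, Polynomial.eval_zero, ← h t, eval_smul_hom]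
    refine Finset.sum_congr rfl fun d _ => ?_
    rw [Polynomial.eval_mul, Polynomial.eval_C, Polynomial.eval_pow, Polynomial.eval_X, mul_comm]
  by_cases hd : d < f.totalDegree + 1
  · have := congrArg (fun p => Polynomial.coeff p d) h0
    simpa [Polynomial.finsetSum_coeff, Polynomial.coeff_C_mul, Polynomial.coeff_X_pow, hd] using this
  · rw [homogeneousComponent_eq_zero _ _ (by omega), map_zero]

theorem isZClosed_zeroLocus [Infinite K] (S : Set (MvPolynomial ι K)) :
    IsZClosed (zeroLocus S) := by
  refine ⟨{g | ∃ f ∈ S, ∃ d, g = homogeneousComponent d f}, ?_, ?_⟩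
  · rintro _ ⟨f, _, d, rfl⟩
    exact ⟨d, homogeneousComponent_isHomogeneous d f⟩
  · ext x
    constructor
    · rintro hx _ ⟨f, hf, d, rfl⟩ v hv
      exact line_vanish f v (fun t => hx f hf _ (x.submodule.smul_mem t hv)) d
    · intro hx f hf v hv
      rw [← sum_homogeneousComponent f, map_sum]
      exact Finset.sum_eq_zero fun d _ => hx _ ⟨f, hf, d, rfl⟩ v hv

theorem mem_zeroLocus_VI {S : Set (PP K ι)} (hS : IsZClosed S) :
    S = zeroLocus (VI (coneOf S) : Set (MvPolynomial ι K)) := by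
  obtain ⟨T, -, rfl⟩ := hS
  ext x
  constructor
  · intro hx f hf v hv
    exact hf v (mem_coneOf.2 ⟨x, hx, hv⟩)
  · intro hx f hf v hv
    refine hx f (fun w hw => ?_) v hv
    obtain ⟨y, hy, hw⟩ := mem_coneOf.1 hw
    exact hy f hf w hw

theorem subset_zclosure (S : Set (PP K ι)) : S ⊆ zclosure S :=
  fun _ hx _ hY => hY.2 hx

theorem zclosure_eq [Infinite K] (S : Set (PP K ι)) :
    zclosure S = zeroLocus (VI (coneOf S) : Set (MvPolynomial ι K)) := by
  apply le_antisymm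
  · intro x hx
    refine hx _ ⟨isZClosed_zeroLocus _, fun y hy f hf v hv => hf v (mem_coneOf.2 ⟨y, hy, hv⟩)⟩
  · rintro x hx Y ⟨hY, hSY⟩
    rw [mem_zeroLocus_VI hY]
    intro f hf v hv
    exact hx f (fun w hw => hf w (coneOf_mono hSY hw)) v hv

theorem zclosure_subset {S Y : Set (PP K ι)} (hY : IsZClosed Y) (h : S ⊆ Y) : zclosure S ⊆ Y :=
  fun _ hx => hx Y ⟨hY, h⟩

theorem VI_zclosure [Infinite K] (S : Set (PP K ι)) {f : MvPolynomial ι K}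
    (hf : f ∈ VI (coneOf S)) : f ∈ VI (coneOf (zclosure S)) := by
  intro v hv
  obtain ⟨x, hx, hv⟩ := mem_coneOf.1 hv
  rw [zclosure_eq] at hx
  exact hx f hf v hv

theorem prime_of_irred [Infinite K] {S : Set (PP K ι)} (hS : IsZIrreducible S) :
    (VI (coneOf S)).IsPrime := by
  obtain ⟨⟨x, hx⟩, hS⟩ := hS
  refine ⟨?_, fun {f g} hfg => ?_⟩
  · rw [Ideal.ne_top_iff_one]
    intro h
    have := h x.rep (mem_coneOf.2 ⟨x, hx, rep_mem x⟩)
    simp at this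
  · have := hS (zeroLocus {f}) (zeroLocus {g}) (isZClosed_zeroLocus _) (isZClosed_zeroLocus _) ?_
    · refine this.imp ?_ ?_
      all_goals
        intro h v hv
        obtain ⟨y, hy, hv⟩ := mem_coneOf.1 hv
        exact h hy _ rfl v hv
    · intro y hy
      by_contra hcon
      have hline : ∀ v ∈ (y.submodule : Set (ι → K)), ∀ w ∈ (y.submodule : Set (ι → K)), ∀ t : K,
          v + t • (w - v) ∈ (y.submodule : Set (ι → K)) := fun v hv w hw t =>
        y.submodule.add_mem hv (y.submodule.smul_mem t (y.submodule.sub_mem hw hv))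
      refine exists_ne_of_lines (y.submodule : Set (ι → K)) hline f g ?_ ?_ ?_
      · intro h; exact hcon (Or.inl (fun f' hf' v hv => by rw [hf']; exact h v hv))
      · intro h; exact hcon (Or.inr (fun f' hf' v hv => by rw [hf']; exact h v hv))
      · intro v hv
        exact hfg v (mem_coneOf.2 ⟨y, hy, hv⟩)

theorem irred_of_prime {S : Set (PP K ι)} (hne : S.Nonempty)
    (hS : ∀ f g : MvPolynomial ι K, f * g ∈ VI (coneOf S) → f ∈ VI (coneOf S) ∨ g ∈ VI (coneOf S)) :
    IsZIrreducible S := by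
  refine ⟨hne, ?_⟩
  rintro _ _ ⟨A, -, rfl⟩ ⟨B, -, rfl⟩ hAB
  by_contra hcon
  push Not at hcon
  obtain ⟨h1, h2⟩ := hcon
  obtain ⟨x, hx, hxA⟩ := Set.not_subset.1 h1
  obtain ⟨y, hy, hyB⟩ := Set.not_subset.1 h2
  simp only [zeroLocus, Set.mem_setOf_eq, not_forall] at hxA hyB
  obtain ⟨f, hf, v, hv, hfv⟩ := hxA
  obtain ⟨g, hg, w, hw, hgw⟩ := hyB
  have hmem : f * g ∈ VI (coneOf S) := by
    intro u hu
    obtain ⟨z, hz, hu⟩ := mem_coneOf.1 hu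
    rw [map_mul]
    rcases hAB hz with h | h
    · rw [h f hf u hu, zero_mul]
    · rw [h g hg u hu, mul_zero]
  rcases hS f g hmem with h | h
  · exact hfv (h v (mem_coneOf.2 ⟨x, hx, hv⟩))
  · exact hgw (h w (mem_coneOf.2 ⟨y, hy, hw⟩))

/-- function field of a prime ideal -/
abbrev FF {σ : Type*} (P : Ideal (MvPolynomial σ K)) [P.IsPrime] := FractionRing (MvPolynomial σ K ⧸ P)

/-- generic point -/
def gp {σ : Type*} (P : Ideal (MvPolynomial σ K)) [P.IsPrime] : σ → FF P :=
  fun i => algebraMap (MvPolynomial σ K ⧸ P) (FF P) (Ideal.Quotient.mk P (X i))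

theorem aeval_gp' {σ : Type*} (P : Ideal (MvPolynomial σ K)) [P.IsPrime] (f : MvPolynomial σ K) :
    aeval (gp P) f = algebraMap (MvPolynomial σ K ⧸ P) (FF P) (Ideal.Quotient.mk P f) := by
  have h : (aeval (gp P) : MvPolynomial σ K →ₐ[K] FF P) =
      (IsScalarTower.toAlgHom K (MvPolynomial σ K ⧸ P) (FF P)).comp (Ideal.Quotient.mkₐ K P) := by
    apply MvPolynomial.algHom_ext
    intro i
    simp [gp]
  exact AlgHom.congr_fun h f

theorem aeval_gp {σ : Type*} (P : Ideal (MvPolynomial σ K)) [P.IsPrime] (f : MvPolynomial σ K) :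
    aeval (gp P) f = 0 ↔ f ∈ P := by
  rw [aeval_gp', ← Ideal.Quotient.eq_zero_iff_mem]
  exact map_eq_zero_iff _ (IsFractionRing.injective _ _)

theorem rk_finite {σ L : Type*} [Finite σ] [Field L] [Algebra K L] (v : σ → L) :
    rk K (Set.range v) ≠ ⊤ := by
  have := Matroid.eRk_le_encard (AlgebraicIndependent.matroid K L) (Set.range v)
  intro h
  have h2 : (Set.range v).encard ≠ ⊤ := Set.encard_ne_top_iff.2 (Set.finite_range v)
  rw [rk] at h
  rw [h] at this
  exact h2 (top_le_iff.1 this)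

theorem rk_gp_lt {σ : Type*} [Finite σ] (P P' : Ideal (MvPolynomial σ K)) [P.IsPrime] [P'.IsPrime]
    (h : P < P') : rk K (Set.range (gp P')) < rk K (Set.range (gp P)) := by
  have h1 : ∀ p : MvPolynomial σ K, aeval (gp P) p = 0 → aeval (gp P') p = 0 := fun p hp => by
    rw [aeval_gp] at hp ⊢; exact h.le hp
  rw [lt_iff_le_not_ge]
  refine ⟨rk_le_of_ker _ _ h1, fun hle => ?_⟩
  have h2 := ker_of_rk_le _ _ h1 (rk_finite _) hle
  refine h.not_ge fun p hp => ?_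
  rw [← aeval_gp] at hp ⊢
  exact h2 p hp

theorem VI_cone_lt {Y Z : Set (PP K ι)} (hY : IsZClosed Y) (h : Y < Z) :
    VI (coneOf Z) < VI (coneOf Y) := by
  rw [lt_iff_le_not_ge]
  refine ⟨fun f hf v hv => hf v (coneOf_mono h.le hv), fun hle => h.not_ge ?_⟩
  rw [mem_zeroLocus_VI hY]
  intro z hz f hf v hv
  exact hle hf v (mem_coneOf.2 ⟨z, hz, hv⟩)

variable [Finite ι]

theorem one_le_rk [Infinite K] {Y : Set (PP K ι)} (hY : Y.Nonempty) [(VI (coneOf Y)).IsPrime] :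
    1 ≤ rk K (Set.range (gp (VI (coneOf Y)))) := by
  by_contra hlt
  have h0 : rk K (Set.range (gp (VI (coneOf Y)))) = 0 := by
    rwa [not_le, ENat.lt_one_iff_eq_zero] at hlt
  obtain ⟨y, hy⟩ := hY
  have h1 : ∀ p : MvPolynomial ι K, aeval (gp (VI (coneOf Y))) p = 0 →
      aeval (fun _ : ι => (0 : K)) p = 0 := fun p hp => by
    rw [aeval_gp] at hp
    exact hp (0 : ι → K) (mem_coneOf.2 ⟨y, hy, y.submodule.zero_mem⟩)
  have h2 := ker_of_rk_le _ _ h1 (rk_finite _) (by rw [h0]; exact zero_le)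
  apply y.rep_nonzero
  ext i
  have h3 := h2 (X i) (by simp)
  rw [aeval_gp] at h3
  simpa using h3 y.rep (mem_coneOf.2 ⟨y, hy, rep_mem y⟩)

/-- dimension is bounded by the rank of a dominating point -/
theorem zdim_le_rk [Infinite K] {Ω : Type*} [Field Ω] [Algebra K Ω] (q : ι → Ω) (S : Set (PP K ι))
    (h : ∀ f : MvPolynomial ι K, aeval q f = 0 → f ∈ VI (coneOf S)) (m : ℕ)
    (hm : ((m : ℕ∞) : WithBot ℕ∞) ≤ zdim S) : ((m + 1 : ℕ) : ℕ∞) ≤ rk K (Set.range q) := by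
  obtain ⟨l, hl⟩ := (Order.le_krullDim_iff).1 hm
  have hp : ∀ i, (VI (coneOf (l i).1)).IsPrime := fun i => prime_of_irred (l i).2.2.1
  have key : ∀ j : ℕ, ∀ hj : j < l.length + 1, ((j + 1 : ℕ) : ℕ∞) ≤
      rk K (Set.range (gp (VI (coneOf (l ⟨j, hj⟩).1)))) := by
    intro j
    induction j with
    | zero =>
      intro hj
      simpa using one_le_rk (l ⟨0, hj⟩).2.2.1.1
    | succ j ih =>
      intro hj
      have h1 := ih (by omega)
      have hlt : l ⟨j, by omega⟩ < l ⟨j + 1, hj⟩ := l.strictMono (by simp)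
      have h2 := rk_gp_lt _ _ (VI_cone_lt (l ⟨j, by omega⟩).2.1 hlt)
      rw [Nat.cast_succ]
      exact Order.add_one_le_of_lt (h1.trans_lt h2)
  have h1 := key m (by omega)
  refine h1.trans (rk_le_of_ker _ _ fun p hp => ?_)
  rw [aeval_gp]
  intro v hv
  exact VI_zclosure S (h p hp) v (coneOf_mono (l ⟨m, _⟩).2.2.2 hv)

end Basics

section LinearSpaces
variable {K : Type*} [Field K] {ι : Type*}

theorem rk_le_of_adjoin {L : Type*} [Field L] [Algebra K L] (S T : Set L)
    (h : S ⊆ Algebra.adjoin K T) : rk K S ≤ rk K T := by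
  have : S ⊆ (AlgebraicIndependent.matroid K L).closure T := fun x hx =>
    adjoin_subset_closure T x (h hx)
  have h2 := Matroid.eRk_mono (AlgebraicIndependent.matroid K L) this
  rwa [Matroid.eRk_closure_eq] at h2

theorem rk_range_le_card {L τ : Type*} [Field L] [Algebra K L] [Fintype τ] (t : τ → L) :
    rk K (Set.range t) ≤ (Fintype.card τ : ℕ∞) := by
  refine (Matroid.eRk_le_encard _ _).trans ?_
  rw [← Set.image_univ]
  refine (Set.encard_image_le _ _).trans ?_
  rw [Set.encard_univ]; simp

/-- projectivization of a submodule -/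
def PS (V : Submodule K (ι → K)) : Set (PP K ι) := {y | y.submodule ≤ V}

theorem mem_coneOf_PS {V : Submodule K (ι → K)} {v : ι → K} (hv : v ≠ 0) :
    v ∈ coneOf (PS V) ↔ v ∈ V := by
  rw [mem_coneOf]
  constructor
  · rintro ⟨x, hx, hv⟩; exact hx hv
  · intro h
    exact ⟨_, (submodule_le_iff hv (mem_submodule_mk hv) V).2 h, mem_submodule_mk hv⟩

theorem coneOf_PS {V : Submodule K (ι → K)} (hV : V ≠ ⊥) : coneOf (PS V) = V := by
  ext v
  by_cases hv : v = 0
  · subst hv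
    obtain ⟨w, hw, hw0⟩ := V.ne_bot_iff.1 hV
    have := smul_mem_coneOf ((mem_coneOf_PS hw0).2 hw) 0
    rw [zero_smul] at this
    exact ⟨fun _ => V.zero_mem, fun _ => this⟩
  · exact mem_coneOf_PS hv

theorem PS_nonempty {V : Submodule K (ι → K)} (hV : V ≠ ⊥) : (PS V).Nonempty := by
  obtain ⟨w, hw, hw0⟩ := V.ne_bot_iff.1 hV
  exact ⟨_, (submodule_le_iff hw0 (mem_submodule_mk hw0) V).2 hw⟩

theorem irred_PS [Infinite K] {V : Submodule K (ι → K)} (hV : V ≠ ⊥) : IsZIrreducible (PS V) := by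
  refine irred_of_prime (PS_nonempty hV) fun f g hfg => ?_
  rw [coneOf_PS hV] at *
  by_contra hcon
  push Not at hcon
  refine exists_ne_of_lines (V : Set (ι → K)) (fun v hv w hw t =>
    V.add_mem hv (V.smul_mem t (V.sub_mem hw hv))) f g hcon.1 hcon.2 hfg

variable [Fintype ι]

/-- linear form as a polynomial -/
def linPoly (h : ι → K) : MvPolynomial ι K := ∑ i, C (h i) * X i

theorem eval_linPoly (h v : ι → K) : eval v (linPoly h) = ∑ i, h i * v i := by
  simp [linPoly]

theorem exists_form (V : Submodule K (ι → K)) {v : ι → K} (hv : v ∉ V) :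
    ∃ h : ι → K, (∀ w ∈ V, ∑ i, h i * w i = 0) ∧ ∑ i, h i * v i ≠ 0 := by
  classical
  obtain ⟨f, hf, hfV⟩ := Submodule.exists_le_ker_of_notMem hv
  have hrep : ∀ w : ι → K, f w = ∑ i, f (Pi.single i 1) * w i := fun w => by
    conv_lhs => rw [← Finset.univ_sum_single w, map_sum]
    refine Finset.sum_congr rfl fun i _ => ?_
    have : (Pi.single i (w i) : ι → K) = w i • Pi.single i 1 := by
      ext j; simp [Pi.single_apply]
    rw [this, map_smul, smul_eq_mul, mul_comm]
  refine ⟨fun i => f (Pi.single i 1), fun w hw => ?_, ?_⟩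
  · rw [← hrep]; exact hfV hw
  · rw [← hrep]; exact hf

theorem isZClosed_PS [Infinite K] (V : Submodule K (ι → K)) : IsZClosed (PS V) := by
  have : PS V = zeroLocus {f | ∃ h : ι → K, f = linPoly h ∧ ∀ w ∈ V, ∑ i, h i * w i = 0} := by
    ext x
    constructor
    · rintro hx _ ⟨h, rfl, hh⟩ v hv
      rw [eval_linPoly]; exact hh v (hx hv)
    · intro hx v hv
      by_contra hcon
      obtain ⟨h, h1, h2⟩ := exists_form V hcon
      refine h2 ?_
      rw [← eval_linPoly]
      exact hx _ ⟨h, rfl, h1⟩ v hv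
  rw [this]
  exact isZClosed_zeroLocus _

theorem zdim_PS_le [Infinite K] (V : Submodule K (ι → K)) (m : ℕ)
    (hm : ((m : ℕ∞) : WithBot ℕ∞) ≤ zdim (PS V)) : m + 1 ≤ Module.finrank K V := by
  obtain ⟨d, hd⟩ : ∃ d, Module.finrank K V = d := ⟨_, rfl⟩
  rw [hd]
  let b := Module.finBasisOfFinrankEq K V hd
  let L := FractionRing (MvPolynomial (Fin d) K)
  let t : Fin d → L := fun j => algebraMap (MvPolynomial (Fin d) K) L (X j)
  let qp : ι → MvPolynomial (Fin d) K := fun i => ∑ j, C ((b j : ι → K) i) * X j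
  let q : ι → L := fun i => algebraMap (MvPolynomial (Fin d) K) L (qp i)
  have hq : ∀ f : MvPolynomial ι K, aeval q f = algebraMap (MvPolynomial (Fin d) K) L (aeval qp f) := by
    intro f
    have : (aeval q : MvPolynomial ι K →ₐ[K] L) =
      (IsScalarTower.toAlgHom K (MvPolynomial (Fin d) K) L).comp (aeval qp) := by
      apply MvPolynomial.algHom_ext; intro i; simp [q]
    exact AlgHom.congr_fun this f
  have h1 := zdim_le_rk q (PS V) (fun f hf v hv => ?_) m hm
  · have h2 : rk K (Set.range q) ≤ rk K (Set.range t) := by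
      apply rk_le_of_adjoin
      rintro _ ⟨i, rfl⟩
      simp only [q, qp, map_sum, map_mul]
      refine Subalgebra.sum_mem _ fun j _ => Subalgebra.mul_mem _ ?_ (Algebra.subset_adjoin ⟨j, rfl⟩)
      have : algebraMap (MvPolynomial (Fin d) K) L (C ((b j : ι → K) i)) =
          algebraMap K L ((b j : ι → K) i) := by
        rw [IsScalarTower.algebraMap_apply K (MvPolynomial (Fin d) K) L]; rfl
      rw [this]
      exact Subalgebra.algebraMap_mem _ _
    have h3 := h1.trans (h2.trans (rk_range_le_card t))
    rw [Fintype.card_fin] at h3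
    exact_mod_cast h3
  · rw [hq] at hf
    have h0 : aeval qp f = 0 := (map_eq_zero_iff _ (IsFractionRing.injective _ _)).1 hf
    have hvV : v ∈ V := by
      obtain ⟨x, hx, hv⟩ := mem_coneOf.1 hv
      exact hx hv
    let c : Fin d → K := fun j => b.repr ⟨v, hvV⟩ j
    have hc : v = fun i => eval c (qp i) := by
      have := congrArg (Subtype.val) (b.sum_repr ⟨v, hvV⟩)
      simp only at this
      have h8 : v = ∑ j, c j • (b j : ι → K) := by
        rw [AddSubmonoidClass.coe_finset_sum] at this
        exact this.symm
      ext i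
      conv_lhs => rw [h8]
      simp [qp, Finset.sum_apply, mul_comm]
    have h5 : eval v f = eval c (aeval qp f) := by
      rw [hc]
      have : (eval (fun i => eval c (qp i)) : MvPolynomial ι K →+* K) =
          (eval c).comp (aeval qp : MvPolynomial ι K →ₐ[K] _).toRingHom := by
        refine MvPolynomial.ringHom_ext (fun r => ?_) (fun i => ?_) <;> simp
      exact RingHom.congr_fun this f
    rw [h5, h0, map_zero]

theorem PS_strict {V W : Submodule K (ι → K)} (h : V < W) : PS V < PS W := by
  rw [lt_iff_le_not_ge]
  refine ⟨fun x hx => le_trans hx h.le, fun hle => h.not_ge fun w hw => ?_⟩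
  by_cases hw0 : w = 0
  · rw [hw0]; exact V.zero_mem
  · exact hle ((submodule_le_iff hw0 (mem_submodule_mk hw0) W).2 hw) (mem_submodule_mk hw0)

theorem zdim_PS_ge [Infinite K] (V : Submodule K (ι → K)) (d : ℕ) (hd : Module.finrank K V = d + 1) :
    ((d : ℕ∞) : WithBot ℕ∞) ≤ zdim (PS V) := by
  let b := Module.finBasisOfFinrankEq K V hd
  let W : Fin (d + 1) → Submodule K (ι → K) := fun i =>
    Submodule.span K ((fun j => (b j : ι → K)) '' {j | j ≤ i})
  have hli : LinearIndependent K (fun j => (b j : ι → K)) :=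
    b.linearIndependent.map' V.subtype (Submodule.ker_subtype V)
  have hmem : ∀ i, (b i : ι → K) ∈ W i := fun i => Submodule.subset_span ⟨i, le_refl i, rfl⟩
  have hWne : ∀ i, W i ≠ ⊥ := fun i h => by
    have := hmem i
    rw [h, Submodule.mem_bot] at this
    exact hli.ne_zero i this
  have hWV : ∀ i, W i ≤ V := fun i => by
    refine Submodule.span_le.2 ?_
    rintro _ ⟨j, -, rfl⟩
    exact (b j).2
  have hmono : StrictMono W := by
    intro i j hij
    rw [lt_iff_le_not_ge]
    constructor
    · exact Submodule.span_mono (Set.image_mono fun l (hl : l ≤ i) => hl.trans hij.le)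
    · intro hle
      have h1 : j ∉ {l | l ≤ i} := fun h => absurd (show j ≤ i from h) hij.not_ge
      exact hli.notMem_span_image h1 (hle (hmem j))
  refine (Order.le_krullDim_iff).2 ⟨LTSeries.mk d (fun i => ⟨PS (W i), isZClosed_PS _, irred_PS (hWne i),
    fun x hx => subset_zclosure _ (le_trans hx (hWV i))⟩) (fun i j hij => ?_), rfl⟩
  exact PS_strict (hmono hij)

theorem natcast_lt_iff (n : ℕ) (x : WithBot ℕ∞) (h : ¬ x ≤ ((n : ℕ∞) : WithBot ℕ∞)) :
    (((n + 1 : ℕ) : ℕ∞) : WithBot ℕ∞) ≤ x := by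
  cases x with
  | bot => exact absurd bot_le h
  | coe y =>
    rw [WithBot.coe_le_coe, not_le] at h
    rw [WithBot.coe_le_coe]
    push_cast
    exact Order.add_one_le_of_lt h

theorem zdim_PS_iff [Infinite K] (V : Submodule K (ι → K)) (n : ℕ) :
    zdim (PS V) = ((n : ℕ∞) : WithBot ℕ∞) ↔ Module.finrank K V = n + 1 := by
  constructor
  · intro h
    have h1 := zdim_PS_le V n h.ge
    obtain ⟨e, he⟩ : ∃ e, Module.finrank K V = e + 1 := ⟨Module.finrank K V - 1, by omega⟩
    have h2 := zdim_PS_ge V e he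
    rw [h, WithBot.coe_le_coe, Nat.cast_le] at h2
    omega
  · intro h
    refine le_antisymm ?_ (zdim_PS_ge V n h)
    by_contra hcon
    have := zdim_PS_le V _ (natcast_lt_iff n _ hcon)
    omega

theorem zdim_mono [Infinite K] {S T : Set (PP K ι)} (h : S ⊆ zclosure T) : zdim S ≤ zdim T := by
  have hs : zclosure S ⊆ zclosure T := zclosure_subset (by rw [zclosure_eq]; exact isZClosed_zeroLocus _) h
  exact Order.krullDim_le_of_strictMono
    (fun Y => (⟨Y.1, Y.2.1, Y.2.2.1, Y.2.2.2.trans hs⟩ :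
      {Y : Set (PP K ι) // IsZClosed Y ∧ IsZIrreducible Y ∧ Y ⊆ zclosure T}))
    (fun Y Z hYZ => hYZ)

end LinearSpaces

section Tangent
variable {K : Type*} [Field K] {ι : Type*} [Fintype ι]

/-- tangent kernel at a point of an extension field -/
def Tker (P : Ideal (MvPolynomial ι K)) {L : Type*} [Field L] [Algebra K L] (z : ι → L) :
    Submodule L (ι → L) where
  carrier := {y | ∀ f ∈ P, ∑ i, aeval z (pderiv i f) * y i = 0}
  add_mem' := fun {a b} ha hb f hf => by
    simp only [Pi.add_apply, mul_add, Finset.sum_add_distrib]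
    rw [ha f hf, hb f hf, add_zero]
  zero_mem' := fun f _ => by simp
  smul_mem' := fun c y hy f hf => by
    have := congrArg (c * ·) (hy f hf)
    simp only [mul_zero, Finset.mul_sum] at this
    rw [← this]
    exact Finset.sum_congr rfl fun i _ => by simp; ring

theorem mem_Tker {P : Ideal (MvPolynomial ι K)} {L : Type*} [Field L] [Algebra K L] {z y : ι → L} :
    y ∈ Tker P z ↔ ∀ f ∈ P, ∑ i, aeval z (pderiv i f) * y i = 0 := Iff.rfl

/-- span of gradients -/
def gradSpan (P : Ideal (MvPolynomial ι K)) : Submodule (MvPolynomial ι K) (ι → MvPolynomial ι K) :=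
  Submodule.span _ {ρ | ∃ f ∈ P, ρ = fun i => pderiv i f}

theorem gradSpan_kill (P : Ideal (MvPolynomial ι K)) {L : Type*} [Field L] [Algebra K L] {z y : ι → L}
    (hy : y ∈ Tker P z) (ρ : ι → MvPolynomial ι K) (hρ : ρ ∈ gradSpan P) :
    ∑ i, aeval z (ρ i) * y i = 0 := by
  induction hρ using Submodule.span_induction with
  | mem x h => obtain ⟨f, hf, rfl⟩ := h; exact hy f hf
  | zero => simp
  | add a b _ _ ha hb =>
    simp only [Pi.add_apply, map_add, add_mul, Finset.sum_add_distrib]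
    rw [ha, hb, add_zero]
  | smul c a _ ha =>
    have := congrArg (aeval z c * ·) ha
    simp only [mul_zero, Finset.mul_sum] at this
    rw [← this]
    exact Finset.sum_congr rfl fun i _ => by simp; ring

theorem sum_proj {F : Type*} [Field F] [DecidableEq ι] (V : Submodule F (ι → F))
    (π : (ι → F) →ₗ[F] (ι → F)) (hπ : LinearMap.IsProj V π) :
    ∑ i, π (Pi.single i 1) i = (Module.finrank F V : F) := by
  have htr := hπ.trace
  rw [LinearMap.trace_eq_matrix_trace F (Pi.basisFun F ι), Matrix.trace] at htr
  rw [← htr]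
  refine Finset.sum_congr rfl fun i _ => ?_
  rw [Matrix.diag_apply, LinearMap.toMatrix_apply]
  simp

theorem exists_B (P : Ideal (MvPolynomial ι K)) [P.IsPrime] [DecidableEq ι] :
    ∃ (δ : MvPolynomial ι K) (B : ι → ι → MvPolynomial ι K), δ ∉ P ∧
      (∀ f ∈ P, ∀ l, ∑ i, pderiv i f * B i l ∈ P) ∧
      (∀ i, (fun l => (if i = l then δ else 0) - B i l) ∈ gradSpan P) ∧
      ∑ i, B i i - (Module.finrank (FF P) (Tker P (gp P)) : MvPolynomial ι K) * δ ∈ P := by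
  obtain ⟨W, hW⟩ := (Tker P (gp P)).exists_isCompl
  let π : (ι → FF P) →ₗ[FF P] (ι → FF P) := (Tker P (gp P)).projection W hW
  have hπ : LinearMap.IsProj (Tker P (gp P)) π :=
    ⟨fun x => by simp [π], fun x hx => by
      simp [π, hx]⟩
  -- rows of 1 - π
  let w : ι → ι → FF P := fun i l => (if i = l then 1 else 0) - π (Pi.single l 1) i
  have hπrep : ∀ y i, π y i = ∑ l, π (Pi.single l 1) i * y l := fun y i => by
    conv_lhs => rw [← Finset.univ_sum_single y, map_sum, Finset.sum_apply]
    refine Finset.sum_congr rfl fun l _ => ?_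
    have : (Pi.single l (y l) : ι → FF P) = y l • Pi.single l 1 := by
      ext j; simp [Pi.single_apply]
    rw [this, map_smul, Pi.smul_apply, smul_eq_mul, mul_comm]
  have hw : ∀ i, w i ∈ Submodule.span (FF P) {ρ | ∃ f ∈ P, ρ = fun i => aeval (gp P) (pderiv i f)} := by
    intro i
    by_contra hcon
    obtain ⟨h, h1, h2⟩ := exists_form _ hcon
    apply h2
    have hT : h ∈ Tker P (gp P) := fun f hf => by
      rw [← h1 _ (Submodule.subset_span ⟨f, hf, rfl⟩)]
      exact Finset.sum_congr rfl fun i _ => mul_comm _ _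
    have h3 := hπ.2 h hT
    have h4 := hπrep h i
    rw [h3] at h4
    simp only [w, mul_sub, Finset.sum_sub_distrib]
    rw [sub_eq_zero]
    simp only [mul_ite, mul_one, mul_zero, Finset.sum_ite_eq, Finset.mem_univ, if_true]
    rw [h4]
    exact Finset.sum_congr rfl fun i _ => mul_comm _ _
  have key : ∀ v ∈ Submodule.span (FF P) {ρ | ∃ f ∈ P, ρ = fun i => aeval (gp P) (pderiv i f)},
      ∃ s ∉ P, ∃ ρ ∈ gradSpan P, ∀ i, aeval (gp P) (ρ i) = aeval (gp P) s * v i := by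
    intro v hv
    have hprime : P.IsPrime := inferInstance
    induction hv using Submodule.span_induction with
    | mem x h =>
      obtain ⟨f, hf, rfl⟩ := h
      exact ⟨1, fun h => hprime.ne_top ((Ideal.eq_top_iff_one P).2 h), _,
        Submodule.subset_span ⟨f, hf, rfl⟩, fun i => by simp⟩
    | zero => exact ⟨1, fun h => hprime.ne_top ((Ideal.eq_top_iff_one P).2 h), 0,
        Submodule.zero_mem _, fun i => by simp⟩
    | add a b _ _ ha hb =>
      obtain ⟨s, hs, ρ, hρ, h1⟩ := ha
      obtain ⟨s', hs', ρ', hρ', h1'⟩ := hb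
      refine ⟨s * s', fun h => (hprime.mem_or_mem h).elim hs hs', s' • ρ + s • ρ',
        Submodule.add_mem _ (Submodule.smul_mem _ _ hρ) (Submodule.smul_mem _ _ hρ'), fun i => ?_⟩
      simp only [Pi.add_apply, Pi.smul_apply, smul_eq_mul, map_add, map_mul, h1, h1']
      ring
    | smul c a _ ha =>
      obtain ⟨s, hs, ρ, hρ, h1⟩ := ha
      obtain ⟨p, q, hq, rfl⟩ := IsFractionRing.div_surjective (A := MvPolynomial ι K ⧸ P) c
      obtain ⟨p, rfl⟩ := Ideal.Quotient.mk_surjective p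
      obtain ⟨q, rfl⟩ := Ideal.Quotient.mk_surjective q
      have hqP : q ∉ P := fun h => nonZeroDivisors.ne_zero hq (Ideal.Quotient.eq_zero_iff_mem.2 h)
      refine ⟨q * s, fun h => (hprime.mem_or_mem h).elim hqP hs, p • ρ,
        Submodule.smul_mem _ _ hρ, fun i => ?_⟩
      have hq0 : aeval (gp P) q ≠ 0 := fun h => hqP ((aeval_gp P q).1 h)
      simp only [Pi.smul_apply, smul_eq_mul, map_mul, h1, ← aeval_gp']
      field_simp
  choose s hs ρ hρ hsρ using fun i => key _ (hw i)
  have hprime : P.IsPrime := inferInstance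
  let δ : MvPolynomial ι K := ∏ i, s i
  have hδ : δ ∉ P := fun h => by
    obtain ⟨i, -, hi⟩ := (hprime.prod_mem_iff).1 h
    exact hs i hi
  let G : ι → ι → MvPolynomial ι K := fun i => (∏ j ∈ Finset.univ.erase i, s j) • ρ i
  have hG : ∀ i l, aeval (gp P) (G i l) = aeval (gp P) δ * w i l := fun i l => by
    simp only [G, δ, Pi.smul_apply, smul_eq_mul, map_mul, hsρ]
    rw [← Finset.mul_prod_erase Finset.univ s (Finset.mem_univ i), map_mul]
    ring
  let B : ι → ι → MvPolynomial ι K := fun i l => (if i = l then δ else 0) - G i l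
  have hB : ∀ i l, aeval (gp P) (B i l) = aeval (gp P) δ * π (Pi.single l 1) i := fun i l => by
    simp only [B, map_sub, hG, w]
    split_ifs
    · ring
    · rw [map_zero]; ring
  refine ⟨δ, B, hδ, fun f hf l => ?_, fun i => ?_, ?_⟩
  · rw [← aeval_gp, map_sum]
    simp only [map_mul, hB]
    have := hπ.1 (Pi.single l 1) f hf
    have h2 := congrArg (aeval (gp P) δ * ·) this
    simp only [mul_zero, Finset.mul_sum] at h2
    rw [← h2]
    exact Finset.sum_congr rfl fun i _ => by ring
  · have : (fun l => (if i = l then δ else 0) - B i l) = G i := by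
      ext l; simp [B]
    rw [this]
    exact Submodule.smul_mem _ _ (hρ i)
  · rw [← aeval_gp, map_sub, map_sum]
    simp only [map_mul, hB, map_natCast]
    rw [← Finset.mul_sum]
    rw [sum_proj _ _ hπ]
    ring

end Tangent

section Tangent2
variable {K : Type*} [Field K] {ι : Type*} [Fintype ι]

/-- the data of `exists_B` -/
structure IsB [DecidableEq ι] (P : Ideal (MvPolynomial ι K)) (d0 : ℕ) (δ : MvPolynomial ι K)
    (B : ι → ι → MvPolynomial ι K) : Prop where
  hδ : δ ∉ P
  col : ∀ f ∈ P, ∀ l, ∑ i, pderiv i f * B i l ∈ P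
  row : ∀ i, (fun l => (if i = l then δ else 0) - B i l) ∈ gradSpan P
  tr : ∑ i, B i i - (d0 : MvPolynomial ι K) * δ ∈ P

variable {P : Ideal (MvPolynomial ι K)} {L : Type*} [Field L] [Algebra K L]

section
variable [DecidableEq ι] {d0 : ℕ} {δ : MvPolynomial ι K} {B : ι → ι → MvPolynomial ι K}

theorem IsB.col_mem (h : IsB P d0 δ B) {z : ι → L} (hz : ∀ f ∈ P, aeval z f = 0) (l : ι) :
    (fun i => aeval z (B i l)) ∈ Tker P z := by
  intro f hf
  have := hz _ (h.col f hf l)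
  simpa [map_sum] using this

theorem IsB.mul_eq (h : IsB P d0 δ B) {z y : ι → L} (hy : y ∈ Tker P z) (i : ι) :
    ∑ l, aeval z (B i l) * y l = aeval z δ * y i := by
  have := gradSpan_kill P hy _ (h.row i)
  simp only [map_sub, sub_mul, Finset.sum_sub_distrib, sub_eq_zero] at this
  rw [← this]
  rw [Finset.sum_eq_single i]
  · simp
  · intro l _ hl; simp [Ne.symm hl]
  · simp

theorem IsB.finrank [CharZero L] (h : IsB P d0 δ B) {z : ι → L} (hz : ∀ f ∈ P, aeval z f = 0)
    (hδ : aeval z δ ≠ 0) : Module.finrank L (Tker P z) = d0 := by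
  let M : Matrix ι ι L := fun i l => (aeval z δ)⁻¹ * aeval z (B i l)
  have happ : ∀ y i, M.mulVecLin y i = (aeval z δ)⁻¹ * ∑ l, aeval z (B i l) * y l := fun y i => by
    rw [Finset.mul_sum]
    simp only [Matrix.mulVecLin_apply, Matrix.mulVec, dotProduct, M]
    exact Finset.sum_congr rfl fun l _ => by ring
  have hp : LinearMap.IsProj (Tker P z) M.mulVecLin := by
    constructor
    · intro y
      have : M.mulVecLin y = ∑ l, ((aeval z δ)⁻¹ * y l) • (fun i => aeval z (B i l)) := by
        ext i
        rw [happ, Finset.sum_apply, Finset.mul_sum]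
        exact Finset.sum_congr rfl fun l _ => by simp; ring
      rw [this]
      exact Submodule.sum_mem _ fun l _ => Submodule.smul_mem _ _ (h.col_mem hz l)
    · intro y hy
      ext i
      rw [happ, h.mul_eq hy, ← mul_assoc, inv_mul_cancel₀ hδ, one_mul]
  have h1 := sum_proj _ _ hp
  have h2 := hz _ h.tr
  rw [map_sub, map_sum, map_mul, map_natCast, sub_eq_zero] at h2
  have h3 : ∀ i, M.mulVecLin (Pi.single i 1) i = (aeval z δ)⁻¹ * aeval z (B i i) := fun i => by
    rw [happ]; simp [Pi.single_apply]
  simp only [h3] at h1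
  rw [← Finset.mul_sum, h2, mul_comm, mul_assoc, mul_inv_cancel₀ hδ, mul_one] at h1
  exact_mod_cast h1.symm
end

theorem exists_dual {F m : Type*} [Field F] [Finite m] [DecidableEq m] (A : m → ι → F)
    (hA : LinearIndependent F A) :
    ∃ h : m → ι → F, ∀ i j, ∑ l, h i l * A j l = if i = j then 1 else 0 := by
  classical
  obtain ⟨g, hg⟩ := LinearMap.exists_leftInverse_of_injective (Finsupp.linearCombination F A)
    (LinearMap.ker_eq_bot.2 hA)
  have hrep : ∀ w : ι → F, g w = ∑ l, w l • g (Pi.single l 1) := fun w => by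
    conv_lhs => rw [← Finset.univ_sum_single w, map_sum]
    refine Finset.sum_congr rfl fun i _ => ?_
    have : (Pi.single i (w i) : ι → F) = w i • Pi.single i 1 := by
      ext j; simp [Pi.single_apply]
    rw [this, map_smul]
  refine ⟨fun i l => g (Pi.single l 1) i, fun i j => ?_⟩
  have h1 := LinearMap.congr_fun hg (Finsupp.single j 1)
  simp only [LinearMap.comp_apply, Finsupp.linearCombination_single, one_smul, LinearMap.id_apply] at h1
  rw [hrep] at h1
  have h2 := congrArg (fun q => q i) h1
  simp only [Finsupp.coe_finset_sum, Finset.sum_apply, Finsupp.coe_smul, Pi.smul_apply, smul_eq_mul] at h2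
  simp only [mul_comm (g _ _)]
  rw [h2, Finsupp.single_apply]
  simp [eq_comm]

theorem finrank_semicont [P.IsPrime] (x : ι → K) (hx : ∀ f ∈ P, eval x f = 0) :
    Module.finrank (FF P) (Tker P (gp P)) ≤ Module.finrank K (Tker P x) := by
  classical
  let S : Set (ι → K) := {ρ | ∃ f ∈ P, ρ = fun i => aeval x (pderiv i f)}
  obtain ⟨b, hbS, hspan, hli⟩ := exists_linearIndependent K S
  haveI : Fintype b := by
    haveI := hli.finite
    exact Fintype.ofFinite b
  choose f hf hfb using fun j : b => hbS j.2
  obtain ⟨h, hh⟩ := exists_dual (fun j : b => (j : ι → K)) hli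
  -- the matrix at x
  let Mx : Matrix b ι K := fun j i => aeval x (pderiv i (f j))
  let Mg : Matrix b ι (FF P) := fun j i => aeval (gp P) (pderiv i (f j))
  have hMx : LinearIndependent K Mx.row := by
    have : Mx.row = fun j : b => (j : ι → K) := by
      ext j i; rw [hfb j]; rfl
    rw [this]; exact hli
  have hker : LinearMap.ker Mx.mulVecLin ≤ Tker P x := by
    intro y hy
    have h1 : ∀ ρ ∈ Submodule.span K S, ∑ i, ρ i * y i = 0 := by
      intro ρ hρ
      rw [← hspan] at hρ
      induction hρ using Submodule.span_induction with
      | mem ρ hρ =>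
        have := congrFun (LinearMap.mem_ker.1 hy) ⟨ρ, hρ⟩
        simp only [Matrix.mulVecLin_apply, Matrix.mulVec, dotProduct, Mx, Pi.zero_apply] at this
        have h5 := hfb ⟨ρ, hρ⟩
        simp only at h5
        rw [h5]; exact this
      | zero => simp
      | add a b _ _ ha hb =>
        simp only [Pi.add_apply, add_mul, Finset.sum_add_distrib]
        rw [ha, hb, add_zero]
      | smul c a _ ha =>
        simp only [Pi.smul_apply, smul_eq_mul, mul_assoc]
        rw [← Finset.mul_sum, ha, mul_zero]
    exact fun g hg => h1 _ (Submodule.subset_span ⟨g, hg, rfl⟩)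
  have hker2 : Tker P (gp P) ≤ LinearMap.ker Mg.mulVecLin := by
    intro y hy
    rw [LinearMap.mem_ker]
    ext j
    exact hy _ (hf j)
  let D : Matrix b b (MvPolynomial ι K) := fun j i => ∑ l, pderiv l (f j) * C (h i l)
  have hD : D.det ∉ P := by
    intro hmem
    have h1 := hx _ hmem
    rw [RingHom.map_det] at h1
    have : (eval x).mapMatrix D = 1 := by
      ext j i
      have h7 : eval x (D j i) = ∑ l, h i l * (j : ι → K) l := by
        change eval x (∑ l, pderiv l (f j) * C (h i l)) = _
        rw [map_sum]
        refine Finset.sum_congr rfl fun l _ => ?_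
        rw [map_mul, eval_C, mul_comm]
        congr 1
        exact (congrFun (hfb j) l).symm
      rw [RingHom.mapMatrix_apply, Matrix.map_apply, h7, hh, Matrix.one_apply]
      simp only [eq_comm]
    rw [this, Matrix.det_one] at h1
    exact one_ne_zero h1
  have hMg : LinearIndependent (FF P) Mg.row := by
    rw [Fintype.linearIndependent_iff]
    intro c hc
    have hdet : ((aeval (gp P) : MvPolynomial ι K →ₐ[K] FF P).toRingHom.mapMatrix D).det ≠ 0 := by
      rw [← RingHom.map_det]
      exact fun h => hD ((aeval_gp P _).1 h)
    have hv : Matrix.vecMul c ((aeval (gp P) : MvPolynomial ι K →ₐ[K] FF P).toRingHom.mapMatrix D) = 0 := by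
      ext i
      have h7 : ∀ j, (aeval (gp P) : MvPolynomial ι K →ₐ[K] FF P).toRingHom.mapMatrix D j i =
          ∑ l, aeval (gp P) (pderiv l (f j)) * aeval (gp P) (C (h i l) : MvPolynomial ι K) := by
        intro j
        change aeval (gp P) (∑ l, pderiv l (f j) * C (h i l)) = _
        rw [map_sum]
        simp only [map_mul]
      simp only [Matrix.vecMul, dotProduct, h7, Finset.mul_sum, Pi.zero_apply]
      rw [Finset.sum_comm]
      refine Finset.sum_eq_zero fun l _ => ?_
      have := congrFun hc l
      simp only [Finset.sum_apply, Pi.smul_apply, smul_eq_mul, Pi.zero_apply] at this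
      have h3 := congrArg (· * aeval (gp P) (C (h i l) : MvPolynomial ι K)) this
      simp only [zero_mul, Finset.sum_mul] at h3
      rw [← h3]
      exact Finset.sum_congr rfl fun j _ => by rw [mul_assoc]; rfl
    exact fun i => congrFun (Matrix.eq_zero_of_vecMul_eq_zero hdet hv) i
  have h1 := LinearMap.finrank_range_add_finrank_ker Mx.mulVecLin
  have h2 := LinearMap.finrank_range_add_finrank_ker Mg.mulVecLin
  have h3 := hMx.rank_matrix
  have h4 := hMg.rank_matrix
  rw [Matrix.rank] at h3 h4
  rw [h3, Module.finrank_fintype_fun_eq_card] at h1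
  rw [h4, Module.finrank_fintype_fun_eq_card] at h2
  have h5 := Submodule.finrank_mono hker
  have h6 := Submodule.finrank_mono hker2
  omega

end Tangent2

section Emb
variable {K : Type*} [Field K] [Infinite K] {ι : Type*} [Fintype ι] {X : Set (PP K ι)}

theorem homComp_mem {f : MvPolynomial ι K} (hf : f ∈ VI (coneOf X)) (d : ℕ) :
    homogeneousComponent d f ∈ VI (coneOf X) := fun v hv =>
  line_vanish f v (fun t => hf _ (smul_mem_coneOf hv t)) d

theorem Tker_of_hom {L : Type*} [Field L] [Algebra K L] (z y : ι → L)
    (h : ∀ f ∈ VI (coneOf X), (∃ d, f.IsHomogeneous d) → ∑ i, aeval z (pderiv i f) * y i = 0) :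
    y ∈ Tker (VI (coneOf X)) z := by
  intro f hf
  rw [← sum_homogeneousComponent f]
  simp only [map_sum, Finset.sum_mul]
  rw [Finset.sum_comm]
  exact Finset.sum_eq_zero fun d _ => h _ (homComp_mem hf d) ⟨d, homogeneousComponent_isHomogeneous d f⟩

theorem euler_mem {L : Type*} [Field L] [Algebra K L] (z : ι → L)
    (hz : ∀ f ∈ VI (coneOf X), aeval z f = 0) : z ∈ Tker (VI (coneOf X)) z := by
  apply Tker_of_hom
  rintro f hf ⟨d, hd⟩
  have h1 := congrArg (aeval z) hd.sum_X_mul_pderiv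
  simp only [map_sum, map_mul, aeval_X, map_nsmul, hz f hf, smul_zero] at h1
  rw [← h1]
  exact Finset.sum_congr rfl fun i _ => mul_comm _ _

theorem aeval_smul_hom {L : Type*} [Field L] [Algebra K L] (f : MvPolynomial ι K) (d : ℕ)
    (hf : f.IsHomogeneous d) (z : ι → L) (c : L) : aeval (c • z) f = c ^ d * aeval z f := by
  rw [aeval_def, aeval_def, eval₂_eq, eval₂_eq, Finset.mul_sum]
  refine Finset.sum_congr rfl fun m hm => ?_
  have hd := hf (mem_support_iff.1 hm)
  simp only [Pi.smul_apply, smul_eq_mul, mul_pow, Finset.prod_mul_distrib]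
  rw [Finset.prod_pow_eq_pow_sum]
  have : ∑ i ∈ m.support, m i = d := by
    rw [← hd]; simp [Finsupp.weight_apply, Finsupp.sum]
  rw [this]; ring

theorem Tker_smul {L : Type*} [Field L] [Algebra K L] (z : ι → L) (c : L) :
    Tker (VI (coneOf X)) z ≤ Tker (VI (coneOf X)) (c • z) := by
  intro y hy
  apply Tker_of_hom
  rintro f hf ⟨d, hd⟩
  have h1 : ∀ i, aeval (c • z) (pderiv i f) = c ^ (d - 1) * aeval z (pderiv i f) := fun i => by
    exact aeval_smul_hom _ _ (hd.pderiv (i := i)) z c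
  simp only [h1, mul_assoc]
  rw [← Finset.mul_sum, hy f hf, mul_zero]

theorem embTangentSpace_eq (x : PP K ι) :
    embTangentSpace X x = PS (Tker (VI (coneOf X)) x.rep) := by
  ext y
  rw [PS, Set.mem_setOf_eq, submodule_le_iff y.rep_nonzero (rep_mem y)]
  constructor
  · intro h
    apply Tker_of_hom
    intro f hf hd
    rw [← h f ⟨hd, fun x hx v hv => hf v (mem_coneOf.2 ⟨x, hx, hv⟩)⟩]
    exact Finset.sum_congr rfl fun i _ => mul_comm _ _
  · rintro h f ⟨hd, hf⟩
    rw [← h f (fun v hv => by obtain ⟨x, hx, hv⟩ := mem_coneOf.1 hv; exact hf x hx v hv)]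
    exact Finset.sum_congr rfl fun i _ => mul_comm _ _

theorem Tker_eq_rep {x : PP K ι} {v : ι → K} (hv : v ≠ 0) (hx : v ∈ x.submodule) :
    Tker (VI (coneOf X)) x.rep = Tker (VI (coneOf X)) v := by
  obtain ⟨c, rfl⟩ := mem_submodule_iff.1 hx
  have hc : c ≠ 0 := fun h => hv (by rw [h, zero_smul])
  refine le_antisymm (Tker_smul _ _) ?_
  have := Tker_smul (X := X) (c • x.rep) c⁻¹
  rwa [smul_smul, inv_mul_cancel₀ hc, one_smul] at this
end Emb

section Der
variable {K : Type*} [Field K] {ι : Type*} [Fintype ι]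

theorem der_aeval {L : Type*} [Field L] [Algebra K L] (D : Derivation K L L) (z : ι → L)
    (f : MvPolynomial ι K) : D (aeval z f) = ∑ i, aeval z (pderiv i f) * D (z i) := by
  classical
  induction f using MvPolynomial.induction_on with
  | C a => simp
  | add p q hp hq =>
    simp only [map_add, hp, hq, add_mul, Finset.sum_add_distrib]
  | mul_X p n hp =>
    rw [map_mul, D.leibniz, hp, aeval_X]
    simp only [Derivation.leibniz, pderiv_X, map_add, smul_eq_mul, map_mul, add_mul,
      Finset.sum_add_distrib, aeval_X, Finset.mul_sum]
    congr 1
    · rw [Finset.sum_eq_single n]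
      · simp
      · intro b _ hb
        simp [Pi.single_apply, hb]
      · simp
    · exact Finset.sum_congr rfl fun i _ => by ring

theorem der_mem_Tker {L : Type*} [Field L] [Algebra K L] {P : Ideal (MvPolynomial ι K)}
    (D : Derivation K L L) (z : ι → L) (hz : ∀ f ∈ P, aeval z f = 0) :
    (fun i => D (z i)) ∈ Tker P z := fun f hf => by
  rw [← der_aeval, hz f hf, map_zero]

theorem der_surj [CharZero K] {κ L : Type*} [Fintype κ] [Field L] [Algebra K L]
    {P : Ideal (MvPolynomial ι K)} (z : κ → ι → L) (hz : ∀ j, ∀ f ∈ P, aeval (z j) f = 0)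
    (hcl : (AlgebraicIndependent.matroid K L).closure (Set.range fun p : κ × ι => z p.1 p.2) = Set.univ)
    (m : ℕ) (hm : (m : ℕ∞) ≤ rk K (Set.univ : Set L)) :
    m ≤ ∑ j, Module.finrank L (Tker P (z j)) ∧
    (∑ j, Module.finrank L (Tker P (z j)) ≤ m → ∀ y : κ → ι → L, (∀ j, y j ∈ Tker P (z j)) →
      ∃ D : Derivation K L L, ∀ j i, D (z j i) = y j i) := by
  let Φ : Derivation K L L →ₗ[L] (∀ j, Tker P (z j)) :=
    { toFun := fun D j => ⟨fun i => D (z j i), der_mem_Tker D (z j) (hz j)⟩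
      map_add' := fun D E => by ext; rfl
      map_smul' := fun c D => by ext; rfl }
  have hΦ : Function.Injective Φ := by
    rw [injective_iff_map_eq_zero]
    intro D hD
    refine derivation_eq_zero _ hcl D ?_
    rintro _ ⟨⟨j, i⟩, rfl⟩
    have := congrArg (fun y => (y j : ι → L) i) hD
    exact this
  obtain ⟨h1, h2⟩ := rank_derivation m hm Φ hΦ
  rw [Module.finrank_pi_fintype] at h1 h2
  refine ⟨h1, fun h y hy => ?_⟩
  obtain ⟨D, hD⟩ := h2 h (fun j => ⟨y j, hy j⟩)
  refine ⟨D, fun j i => ?_⟩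
  have := congrArg (fun y => (y j : ι → L) i) hD
  exact this

instance FF_faithful {σ : Type*} (P : Ideal (MvPolynomial σ K)) [P.IsPrime] :
    FaithfulSMul K (FF P) :=
  (faithfulSMul_iff_algebraMap_injective K (FF P)).2 (algebraMap K (FF P)).injective

theorem closure_gp {σ : Type*} (P : Ideal (MvPolynomial σ K)) [P.IsPrime] :
    (AlgebraicIndependent.matroid K (FF P)).closure (Set.range (gp P)) = Set.univ := by
  rw [Set.eq_univ_iff_forall]
  intro x
  obtain ⟨p, q, hq, rfl⟩ := IsFractionRing.div_surjective (A := MvPolynomial σ K ⧸ P) x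
  obtain ⟨p, rfl⟩ := Ideal.Quotient.mk_surjective p
  obtain ⟨q, rfl⟩ := Ideal.Quotient.mk_surjective q
  rw [mem_closure_iff, ← aeval_gp', ← aeval_gp', div_eq_mul_inv]
  have h : ∀ f : MvPolynomial σ K, IsAlgebraic (Algebra.adjoin K (Set.range (gp P))) (aeval (gp P) f) :=
    fun f => by
      rw [← mem_closure_iff]
      apply adjoin_subset_closure
      rw [Algebra.adjoin_range_eq_range_aeval]
      exact ⟨f, rfl⟩
  exact (h p).mul (h q).inv

theorem rk_gp [CharZero K] {X : Set (PP K ι)} [(VI (coneOf X)).IsPrime] (n : ℕ)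
    (hn : zdim X = ((n : ℕ∞) : WithBot ℕ∞)) (x0 : PP K ι) (hx0 : IsSmoothPoint X x0) :
    rk K (Set.range (gp (VI (coneOf X)))) = ((n + 1 : ℕ) : ℕ∞) ∧
    Module.finrank (FF (VI (coneOf X))) (Tker (VI (coneOf X)) (gp (VI (coneOf X)))) = n + 1 := by
  have h1 := zdim_le_rk (gp (VI (coneOf X))) X (fun f hf => (aeval_gp _ f).1 hf) n hn.ge
  obtain ⟨r, hr⟩ := ENat.ne_top_iff_exists.1 (rk_finite (K := K) (gp (VI (coneOf X))))
  have hcl : (AlgebraicIndependent.matroid K (FF (VI (coneOf X)))).closure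
      (Set.range fun p : Unit × ι => gp (VI (coneOf X)) p.2) = Set.univ := by
    rw [← closure_gp]
    congr 1
    ext x; simp
  have h2 := (der_surj (fun _ : Unit => gp (VI (coneOf X)))
    (fun _ f hf => (aeval_gp _ f).2 hf) hcl r
    (hr.le.trans (Matroid.eRk_mono _ (Set.subset_univ _)))).1
  simp only [Finset.univ_unique, Finset.sum_singleton] at h2
  have h3 := finrank_semicont x0.rep (P := VI (coneOf X))
    (fun f hf => hf _ (mem_coneOf.2 ⟨x0, hx0.1, rep_mem x0⟩))
  have h4 := hx0.2
  rw [embTangentSpace_eq, hn, zdim_PS_iff] at h4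
  rw [h4] at h3
  rw [← hr] at h1 ⊢
  have h5 : n + 1 ≤ r := by exact_mod_cast h1
  refine ⟨?_, by omega⟩
  have : r = n + 1 := by omega
  rw [this]

/-- cone power -/
def CM (κ : Type*) (X : Set (PP K ι)) : Set (κ × ι → K) :=
  {v | ∀ i, (fun l => v (i, l)) ∈ coneOf X}

theorem CM_prime_aux {κ : Type*} [Fintype κ] {X : Set (PP K ι)} (hP : (VI (coneOf X)).IsPrime)
    (f g : MvPolynomial (κ × ι) K) (hf : f ∉ VI (CM κ X)) (hg : g ∉ VI (CM κ X)) :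
    f * g ∉ VI (CM κ X) := by
  classical
  simp only [mem_VI, not_forall] at hf hg ⊢
  obtain ⟨a, ha, hfa⟩ := hf
  obtain ⟨b, hb, hgb⟩ := hg
  let upd : (κ × ι → K) → κ → (ι → K) → (κ × ι → K) := fun v i x p => if p.1 = i then x p.2 else v p
  have hupd : ∀ (h : MvPolynomial (κ × ι) K) (v : κ × ι → K) (i : κ), ∃ q : MvPolynomial ι K,
      ∀ x, eval x q = eval (upd v i x) h := by
    intro h v i
    refine ⟨aeval (fun p : κ × ι => if p.1 = i then MvPolynomial.X p.2 else C (v p)) h, fun x => ?_⟩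
    have : (eval x).comp (aeval (fun p : κ × ι => if p.1 = i then MvPolynomial.X p.2 else C (v p)) :
        MvPolynomial (κ × ι) K →ₐ[K] MvPolynomial ι K).toRingHom = eval (upd v i x) := by
      refine MvPolynomial.ringHom_ext (fun r => ?_) (fun p => ?_)
      · simp
      · simp only [RingHom.comp_apply, AlgHom.toRingHom_eq_coe, RingHom.coe_coe, aeval_X, eval_X, upd]
        split_ifs <;> simp
    exact RingHom.congr_fun this h
  let pw : Finset κ → (κ × ι → K) → (κ × ι → K) → (κ × ι → K) := fun s w v p => if p.1 ∈ s then w p else v p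
  have key : ∀ s : Finset κ, ∃ w ∈ CM κ X, eval (pw s w a) f ≠ 0 ∧ eval (pw s w b) g ≠ 0 := by
    intro s
    induction s using Finset.induction_on with
    | empty => exact ⟨a, ha, by simpa [pw] using hfa, by simpa [pw] using hgb⟩
    | insert i s hi ih =>
      obtain ⟨w, hw, h1, h2⟩ := ih
      obtain ⟨q1, hq1⟩ := hupd f (pw s w a) i
      obtain ⟨q2, hq2⟩ := hupd g (pw s w b) i
      have e : ∀ v, upd (pw s w v) i (fun l => v (i, l)) = pw s w v := fun v => by
        ext ⟨j, l⟩
        simp only [upd, pw]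
        split_ifs with h3 h4 <;> first | rfl | skip
        · subst h3; exact absurd h4 hi
        · subst h3; rfl
      have n1 : q1 ∉ VI (coneOf X) := fun h => h1 (by have := h _ (ha i); rw [hq1, e] at this; exact this)
      have n2 : q2 ∉ VI (coneOf X) := fun h => h2 (by have := h _ (hb i); rw [hq2, e] at this; exact this)
      have n3 : q1 * q2 ∉ VI (coneOf X) := fun h => (hP.mem_or_mem h).elim n1 n2
      simp only [mem_VI, not_forall] at n3
      obtain ⟨x, hx, hxq⟩ := n3
      rw [map_mul, hq1, hq2] at hxq
      have e2 : ∀ v, pw (insert i s) (upd w i x) v = upd (pw s w v) i x := fun v => by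
        ext ⟨j, l⟩
        simp only [upd, pw, Finset.mem_insert]
        by_cases h3 : j = i <;> simp [h3]
      refine ⟨upd w i x, fun j => ?_, ?_, ?_⟩
      · by_cases h3 : j = i
        · simp only [upd, h3, if_true]; exact hx
        · simp only [upd, h3, if_false]; exact hw j
      · rw [e2]; exact left_ne_zero_of_mul hxq
      · rw [e2]; exact right_ne_zero_of_mul hxq
  obtain ⟨w, hw, h1, h2⟩ := key Finset.univ
  have e : ∀ v, pw Finset.univ w v = w := fun v => by ext p; simp [pw]
  rw [e] at h1 h2
  exact ⟨w, hw, by rw [map_mul]; exact mul_ne_zero h1 h2⟩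

theorem CM_prime {κ : Type*} [Fintype κ] {X : Set (PP K ι)} (hP : (VI (coneOf X)).IsPrime)
    (hne : X.Nonempty) : (VI (CM κ X)).IsPrime := by
  refine ⟨?_, fun {f g} hfg => ?_⟩
  · rw [Ideal.ne_top_iff_one]
    intro h
    obtain ⟨x, hx⟩ := hne
    have := h 0 (fun i => mem_coneOf.2 ⟨x, hx, x.submodule.zero_mem⟩)
    simp at this
  · by_contra hcon
    push Not at hcon
    exact CM_prime_aux hP f g hcon.1 hcon.2 hfg

end Der

section Sec
variable {K : Type*} [Field K] {ι : Type*} [Fintype ι]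

theorem vspan_range {κ : Type*} [Fintype κ] (w : κ → PP K ι) {v : ι → K}
    (hv : v ∈ vspan (Set.range w)) :
    ∃ c : κ → ι → K, (∀ i, c i ∈ (w i).submodule) ∧ ∑ i, c i = v := by
  classical
  induction hv using Submodule.span_induction with
  | mem x hx =>
    obtain ⟨_, ⟨i, rfl⟩, hx⟩ := mem_coneOf.1 hx
    refine ⟨fun j => if j = i then x else 0, fun j => ?_, by simp⟩
    by_cases h : j = i
    · subst h; simpa using hx
    · simp [h]
  | zero => exact ⟨0, fun i => Submodule.zero_mem _, by simp⟩
  | add x y _ _ hx hy =>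
    obtain ⟨c, h1, h2⟩ := hx
    obtain ⟨c', h1', h2'⟩ := hy
    exact ⟨c + c', fun i => Submodule.add_mem _ (h1 i) (h1' i), by
      rw [← h2, ← h2', ← Finset.sum_add_distrib]; rfl⟩
  | smul t x _ hx =>
    obtain ⟨c, h1, h2⟩ := hx
    exact ⟨t • c, fun i => Submodule.smul_mem _ t (h1 i), by
      rw [← h2, Finset.smul_sum]; rfl⟩

theorem rk_iUnion_le {L κ : Type*} [Fintype κ] [Field L] [Algebra K L] (z : κ → ι → L) (d : ℕ)
    (hz : ∀ i, rk K (Set.range (z i)) ≤ d) :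
    rk K (Set.range fun p : κ × ι => z p.1 p.2) ≤ ((Fintype.card κ * d : ℕ) : ℕ∞) := by
  classical
  have key : ∀ s : Finset κ, rk K (⋃ i ∈ s, Set.range (z i)) ≤ ((s.card * d : ℕ) : ℕ∞) := by
    intro s
    induction s using Finset.induction_on with
    | empty => simp
    | insert i s hi ih =>
      rw [Finset.set_biUnion_insert, Finset.card_insert_of_notMem hi]
      refine (Matroid.eRk_union_le_eRk_add_eRk _ _ _).trans ?_
      refine (add_le_add (hz i) ih).trans ?_
      rw [← Nat.cast_add]
      exact_mod_cast (by ring_nf; rfl)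
  refine le_trans (Matroid.eRk_mono _ ?_) (key Finset.univ)
  rintro _ ⟨⟨i, l⟩, rfl⟩
  exact Set.mem_biUnion (Finset.mem_univ i) ⟨l, rfl⟩

theorem secant_rk [Infinite K] {X : Set (PP K ι)} (m M : ℕ) [(VI (CM (Fin m) X)).IsPrime]
    (hsec : ((M : ℕ∞) : WithBot ℕ∞) ≤ zdim (secant m X)) :
    ((M + 1 : ℕ) : ℕ∞) ≤ rk K (Set.range fun l => ∑ i, gp (VI (CM (Fin m) X)) (i, l)) := by
  refine zdim_le_rk _ (secant m X) (fun f hf => ?_) M hsec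
  refine VI_zclosure _ ?_
  intro v hv
  obtain ⟨x, ⟨B, hBX, hBc, hxB⟩, hv⟩ := mem_coneOf.1 hv
  have hv2 : v ∈ vspan (B : Set (PP K ι)) := hxB hv
  let e := (B.equivFinOfCardEq hBc).symm
  have hr : (B : Set (PP K ι)) = Set.range (fun i => (e i : PP K ι)) := by
    ext y
    constructor
    · intro hy
      exact ⟨e.symm ⟨y, hy⟩, by simp⟩
    · rintro ⟨i, rfl⟩
      exact (e i).2
  rw [hr] at hv2
  obtain ⟨c, h1, h2⟩ := vspan_range _ hv2
  let φ : MvPolynomial ι K →ₐ[K] MvPolynomial (Fin m × ι) K := aeval fun l => ∑ i, MvPolynomial.X (i, l)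
  have hφ : φ f ∈ VI (CM (Fin m) X) := by
    rw [← aeval_gp, ← hf]
    have : (aeval (gp (VI (CM (Fin m) X)))).comp φ
        = aeval (fun l => ∑ i, gp (VI (CM (Fin m) X)) (i, l)) := by
      ext l; simp [φ]
    exact AlgHom.congr_fun this f
  have h3 := hφ (fun p => c p.1 p.2) (fun i => mem_coneOf.2 ⟨e i, hBX (e i).2, h1 i⟩)
  rw [← h3, ← h2]
  have : (aeval (fun p : Fin m × ι => c p.1 p.2)).comp φ = (aeval (∑ i, c i) : MvPolynomial ι K →ₐ[K] K) := by
    ext l; simp [φ]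
  have := AlgHom.congr_fun this f
  simpa [aeval_eq_eval] using this.symm

theorem sec_rk [CharZero K] {X : Set (PP K ι)} (hX : IsZIrreducible X) (n k m : ℕ) (hkm : k ≤ m)
    (hm : 1 ≤ m) (hgp : ∀ h : (VI (coneOf X)).IsPrime, rk K (Set.range (gp (VI (coneOf X)))) = ((n + 1 : ℕ) : ℕ∞))
    (hsec : zdim (secant m X) = (((m * (n + 1) - 1 : ℕ) : ℕ∞) : WithBot ℕ∞))
    {Ω : Type*} [Field Ω] [Algebra K Ω] (x : Fin k → ι → Ω)
    (hx : ∀ F : MvPolynomial (Fin k × ι) K, aeval (fun p => x p.1 p.2) F = 0 → F ∈ VI (CM (Fin k) X)) :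
    ((k * (n + 1) : ℕ) : ℕ∞) ≤ rk K (Set.range fun l => ∑ i, x i l) := by
  haveI : Infinite K := inferInstance
  have hP := prime_of_irred hX
  obtain ⟨r, rfl⟩ := Nat.exists_eq_add_of_le hkm
  haveI hPm : (VI (CM (Fin (k + r)) X)).IsPrime := CM_prime hP hX.1
  set z := gp (VI (CM (Fin (k + r)) X)) with hz
  have h1 := secant_rk (k + r) _ hsec.ge
  have h0 : (k + r) * (n + 1) - 1 + 1 = (k + r) * (n + 1) :=
    Nat.sub_add_cancel (Nat.mul_pos hm (Nat.succ_pos n))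
  rw [h0] at h1
  have hzi : ∀ i, rk K (Set.range fun l => z (i, l)) ≤ ((n + 1 : ℕ) : ℕ∞) := by
    intro i
    rw [← hgp hP]
    refine rk_le_of_ker _ _ (fun f hf => ?_)
    rw [aeval_gp] at hf
    have : (aeval z) (rename (fun l => (i, l)) f) = 0 := by
      rw [hz, aeval_gp]
      intro v hv
      rw [eval_rename]
      exact hf _ (hv i)
    rw [aeval_rename] at this
    exact this
  have h2 := rk_iUnion_le (K := K) (fun (i : Fin r) l => z (Fin.natAdd k i, l)) (n + 1) (fun i => hzi _)
  have h3 : rk K (Set.range fun l => ∑ i, z (i, l)) ≤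
      rk K (Set.range fun l => ∑ i : Fin k, z (Fin.castAdd r i, l)) +
      rk K (Set.range fun p : Fin r × ι => z (Fin.natAdd k p.1, p.2)) := by
    refine le_trans (rk_le_of_adjoin _ _ ?_) (Matroid.eRk_union_le_eRk_add_eRk _ _ _)
    rintro _ ⟨l, rfl⟩
    simp only [Fin.sum_univ_add]
    refine Subalgebra.add_mem _ (Algebra.subset_adjoin (Or.inl ⟨l, rfl⟩)) ?_
    exact Subalgebra.sum_mem _ fun i _ => Algebra.subset_adjoin (Or.inr ⟨(i, l), rfl⟩)
  have h4 : rk K (Set.range fun l => ∑ i : Fin k, z (Fin.castAdd r i, l)) ≤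
      rk K (Set.range fun l => ∑ i, x i l) := by
    refine rk_le_of_ker _ _ (fun f hf => ?_)
    let φ : MvPolynomial ι K →ₐ[K] MvPolynomial (Fin k × ι) K := aeval fun l => ∑ i, MvPolynomial.X (i, l)
    have h5 : (aeval (fun p : Fin k × ι => x p.1 p.2)).comp φ = aeval (fun l => ∑ i, x i l) := by
      ext l; simp [φ]
    have h6 := hx (φ f) (by rw [← hf, ← h5]; rfl)
    have h7 : (aeval (fun p : Fin k × ι => z (Fin.castAdd r p.1, p.2))).comp φ
        = aeval (fun l => ∑ i, z (Fin.castAdd r i, l)) := by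
      ext l; simp [φ]
    rw [← h7]
    have : (aeval z) (rename (fun p : Fin k × ι => (Fin.castAdd r p.1, p.2)) (φ f)) = 0 := by
      rw [hz, aeval_gp]
      intro v hv
      rw [eval_rename]
      exact h6 _ (fun i => hv (Fin.castAdd r i))
    rw [aeval_rename] at this
    exact this
  have h8 := (h1.trans h3).trans (add_le_add h4 h2)
  rw [Fintype.card_fin, add_mul, Nat.cast_add] at h8
  exact (ENat.add_le_add_iff_right (ENat.coe_ne_top _)).1 h8

end Sec

section Gen
variable {K : Type*} [Field K] {ι : Type*} [Fintype ι]

theorem closure_eq_of {L : Type*} [Field L] [Algebra K L] (S T : Set L)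
    (h : S ⊆ Algebra.adjoin K T) (hf : rk K S ≠ ⊤) (hr : rk K T ≤ rk K S) :
    (AlgebraicIndependent.matroid K L).closure S = (AlgebraicIndependent.matroid K L).closure T := by
  have h1 : S ⊆ (AlgebraicIndependent.matroid K L).closure T := fun x hx =>
    adjoin_subset_closure T x (h hx)
  have h2 : (AlgebraicIndependent.matroid K L).IsRkFinite S := by
    rw [← Matroid.eRk_ne_top_iff]; exact hf
  rw [h2.closure_eq_closure_of_subset_of_eRk_ge_eRk h1 (by rw [Matroid.eRk_closure_eq]; exact hr)]
  exact Matroid.closure_closure _ _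

theorem gen_family {k d : ℕ} {P : Ideal (MvPolynomial ι K)} [P.IsPrime]
    (hd : rk K (Set.range (gp P)) = (d : ℕ∞)) {Ω : Type*} [Field Ω] [Algebra K Ω]
    (z : Fin k → ι → Ω) (hz : ∀ i, ∀ f ∈ P, aeval (z i) f = 0)
    (hr : ((k * d : ℕ) : ℕ∞) ≤ rk K (Set.range fun p : Fin k × ι => z p.1 p.2)) (j : Fin k)
    (f : MvPolynomial ι K) (hf : aeval (z j) f = 0) : f ∈ P := by
  classical
  have hle : ∀ i, rk K (Set.range (z i)) ≤ (d : ℕ∞) := fun i => by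
    rw [← hd]
    exact rk_le_of_ker _ _ fun f hf => hz i f ((aeval_gp P f).1 hf)
  have h1 : rk K (Set.range fun p : Fin k × ι => z p.1 p.2) ≤ rk K (Set.range (z j)) +
      rk K (Set.range fun p : {i // i ≠ j} × ι => z p.1 p.2) := by
    refine le_trans (Matroid.eRk_mono _ ?_) (Matroid.eRk_union_le_eRk_add_eRk _ _ _)
    rintro _ ⟨⟨i, l⟩, rfl⟩
    by_cases h : i = j
    · subst h; exact Or.inl ⟨l, rfl⟩
    · exact Or.inr ⟨(⟨i, h⟩, l), rfl⟩
  have h2 := rk_iUnion_le (K := K) (fun i : {i // i ≠ j} => z i) d (fun i => hle i)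
  have hk : k = 1 + (k - 1) := by have := j.pos; omega
  have hc : Fintype.card {i // i ≠ j} = k - 1 := by simp
  rw [hc] at h2
  have h3 := (hr.trans h1).trans (add_le_add le_rfl h2)
  have h4 : k * d = d + (k - 1) * d := by
    conv_lhs => rw [hk]
    ring
  rw [h4, Nat.cast_add] at h3
  have h5 := (ENat.add_le_add_iff_right (ENat.coe_ne_top _)).1 h3
  rw [← aeval_gp]
  refine ker_of_rk_le (gp P) (z j) (fun f hf => hz j f ((aeval_gp P f).1 hf)) ?_ (hd.le.trans h5) f hf
  exact ne_top_of_le_ne_top (ENat.coe_ne_top d) (hle j)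

theorem gen_der [CharZero K] [DecidableEq ι] {k d : ℕ} {P : Ideal (MvPolynomial ι K)} [P.IsPrime]
    {δ : MvPolynomial ι K} {B : ι → ι → MvPolynomial ι K} (hB : IsB P d δ B)
    (hd : rk K (Set.range (gp P)) = (d : ℕ∞)) {Ω : Type*} [Field Ω] [Algebra K Ω]
    (z : Fin k → ι → Ω) (hz : ∀ i, ∀ f ∈ P, aeval (z i) f = 0)
    (hr : ((k * d : ℕ) : ℕ∞) ≤ rk K (Set.range fun p : Fin k × ι => z p.1 p.2))
    (hcl : (AlgebraicIndependent.matroid K Ω).closure (Set.range fun p : Fin k × ι => z p.1 p.2) = Set.univ)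
    (y : Fin k → ι → Ω) (hy : ∀ j, y j ∈ Tker P (z j)) :
    ∃ D : Derivation K Ω Ω, ∀ j i, D (z j i) = y j i := by
  haveI : CharZero Ω := charZero_of_injective_algebraMap (algebraMap K Ω).injective
  refine (der_surj z hz hcl (k * d) (hr.trans (Matroid.eRk_mono _ (Set.subset_univ _)))).2 ?_ y hy
  rw [Finset.sum_congr rfl fun j _ => hB.finrank (hz j)
    (fun h => hB.hδ (gen_family hd z hz hr j δ h))]
  simp

/-- generic span of the tangent spaces -/
def Mspan {k : ℕ} {Ω : Type*} [Field Ω] [Algebra K Ω] (B : ι → ι → MvPolynomial ι K)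
    (x : Fin k → ι → Ω) : Submodule Ω (ι → Ω) :=
  Submodule.span Ω (Set.range fun p : Fin k × ι => fun t => aeval (x p.1) (B t p.2))

theorem generic_main [CharZero K] [DecidableEq ι] {k d : ℕ} {P : Ideal (MvPolynomial ι K)} [P.IsPrime]
    {δ : MvPolynomial ι K} {B : ι → ι → MvPolynomial ι K} (hB : IsB P d δ B)
    (hd : rk K (Set.range (gp P)) = (d : ℕ∞)) {Ω : Type*} [Field Ω] [Algebra K Ω]
    (hhom : ∀ (z : ι → Ω), (∀ f ∈ P, aeval z f = 0) → z ∈ Tker P z)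
    (x c : Fin k → ι → Ω) (hx : ∀ i, ∀ f ∈ P, aeval (x i) f = 0)
    (hc : ∀ i, ∀ f ∈ P, aeval (c i) f = 0) (hxc : ∀ l, ∑ i, x i l = ∑ i, c i l)
    (hr : ((k * d : ℕ) : ℕ∞) ≤ rk K (Set.range fun l => ∑ i, x i l))
    (hcl : (AlgebraicIndependent.matroid K Ω).closure ((Set.range fun p : Fin k × ι => x p.1 p.2) ∪
      (Set.range fun p : Fin k × ι => c p.1 p.2)) = Set.univ) :
    (∀ i f, aeval (x i) f = 0 → f ∈ P) ∧ (∀ i f, aeval (c i) f = 0 → f ∈ P) ∧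
    (AlgebraicIndependent.matroid K Ω).closure (Set.range fun p : Fin k × ι => x p.1 p.2) = Set.univ ∧
    ∀ j, ∃ e : Derivation K Ω Ω, (∀ l, ∑ i, e (x i l) = c j l) ∧
      ∀ y ∈ Mspan B x, (fun t => e (y t)) ∈ Mspan B x := by
  have qx : (Set.range fun l => ∑ i, x i l) ⊆
      Algebra.adjoin K (Set.range fun p : Fin k × ι => x p.1 p.2) := by
    rintro _ ⟨l, rfl⟩
    exact Subalgebra.sum_mem _ fun i _ => Algebra.subset_adjoin ⟨(i, l), rfl⟩
  have qc : (Set.range fun l => ∑ i, x i l) ⊆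
      Algebra.adjoin K (Set.range fun p : Fin k × ι => c p.1 p.2) := by
    rintro _ ⟨l, rfl⟩
    simp only [hxc]
    exact Subalgebra.sum_mem _ fun i _ => Algebra.subset_adjoin ⟨(i, l), rfl⟩
  have hfin := rk_finite (K := K) (fun l => ∑ i, x i l)
  have ub : ∀ z : Fin k → ι → Ω, (∀ i, ∀ f ∈ P, aeval (z i) f = 0) →
      rk K (Set.range fun p : Fin k × ι => z p.1 p.2) ≤ ((k * d : ℕ) : ℕ∞) := fun z hz => by
    have := rk_iUnion_le (K := K) z d (fun i => by
      rw [← hd]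
      exact rk_le_of_ker _ _ fun f hf => hz i f ((aeval_gp P f).1 hf))
    rwa [Fintype.card_fin] at this
  have clx := closure_eq_of _ _ qx hfin ((ub x hx).trans hr)
  have clc := closure_eq_of _ _ qc hfin ((ub c hc).trans hr)
  have clq : (AlgebraicIndependent.matroid K Ω).closure (Set.range fun l => ∑ i, x i l) = Set.univ := by
    rw [Set.eq_univ_iff_forall]
    intro w
    have hw : w ∈ (AlgebraicIndependent.matroid K Ω).closure ((Set.range fun p : Fin k × ι => x p.1 p.2) ∪
      (Set.range fun p : Fin k × ι => c p.1 p.2)) := by rw [hcl]; trivial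
    rw [← Matroid.closure_closure]
    refine Matroid.closure_subset_closure _ ?_ hw
    apply Set.union_subset
    · rw [clx]; exact Matroid.subset_closure _ _ (by simp [AlgebraicIndependent.matroid_e])
    · rw [clc]; exact Matroid.subset_closure _ _ (by simp [AlgebraicIndependent.matroid_e])
  have rx := hr.trans (rk_le_of_adjoin _ _ qx)
  have rc := hr.trans (rk_le_of_adjoin _ _ qc)
  have gx := gen_family hd x hx rx
  have gc := gen_family hd c hc rc
  rw [clq] at clx clc
  have dx := gen_der hB hd x hx rx clx.symm
  have dc := gen_der hB hd c hc rc clc.symm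
  -- `M` in terms of derivations
  have M1 : ∀ D : Derivation K Ω Ω, (fun l => D (∑ i, x i l)) ∈ Mspan B x := fun D => by
    have h1 : (fun l => D (∑ i, x i l)) = ∑ i, ∑ l, ((aeval (x i) δ)⁻¹ * D (x i l)) •
        (fun t => aeval (x i) (B t l)) := by
      ext t
      rw [map_sum, Finset.sum_apply]
      refine Finset.sum_congr rfl fun i _ => ?_
      have h2 := hB.mul_eq (der_mem_Tker D (x i) (hx i)) t
      have h3 : aeval (x i) δ ≠ 0 := fun h => hB.hδ (gx i δ h)
      rw [Finset.sum_apply]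
      simp only [Pi.smul_apply, smul_eq_mul]
      rw [eq_comm, ← mul_right_inj' h3, ← h2, Finset.mul_sum]
      refine Finset.sum_congr rfl fun l _ => ?_
      field_simp
    rw [h1]
    exact Submodule.sum_mem _ fun i _ => Submodule.sum_mem _ fun l _ =>
      Submodule.smul_mem _ _ (Submodule.subset_span ⟨(i, l), rfl⟩)
  have M2 : ∀ y ∈ Mspan B x, ∃ D : Derivation K Ω Ω, ∀ l, D (∑ i, x i l) = y l := by
    intro y hy
    induction hy using Submodule.span_induction with
    | mem y hy =>
      obtain ⟨⟨i, l⟩, rfl⟩ := hy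
      classical
      obtain ⟨D, hD⟩ := dx (fun j => if j = i then (fun t => aeval (x i) (B t l)) else 0) (fun j => by
        by_cases h : j = i
        · subst h; simpa using hB.col_mem (hx j) l
        · simp [h])
      refine ⟨D, fun t => ?_⟩
      rw [map_sum, Finset.sum_eq_single i]
      · rw [hD]; simp
      · intro j _ hj; rw [hD]; simp [hj]
      · simp
    | zero => exact ⟨0, by simp⟩
    | add y y' _ _ h h' =>
      obtain ⟨D, hD⟩ := h
      obtain ⟨D', hD'⟩ := h'
      exact ⟨D + D', fun l => by rw [Derivation.add_apply, hD, hD']; rfl⟩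
    | smul a y _ h =>
      obtain ⟨D, hD⟩ := h
      exact ⟨a • D, fun l => by rw [Derivation.smul_apply, hD]; rfl⟩
  refine ⟨gx, gc, clx.symm, fun j => ?_⟩
  classical
  have single : ∀ w ∈ Tker P (c j), ∃ D : Derivation K Ω Ω, ∀ l, D (∑ i, x i l) = w l := by
    intro w hw
    obtain ⟨D, hD⟩ := dc (fun i => if i = j then w else 0) (fun i => by
      by_cases h : i = j
      · subst h; simpa using hw
      · simp [h])
    refine ⟨D, fun t => ?_⟩
    rw [hxc, map_sum, Finset.sum_eq_single j]
    · rw [hD]; simp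
    · intro i _ hj; rw [hD]; simp [hj]
    · simp
  obtain ⟨e, he⟩ := single (c j) (hhom (c j) (hc j))
  refine ⟨e, fun l => by rw [← he, map_sum], fun y hy => ?_⟩
  obtain ⟨D, hD⟩ := M2 y hy
  obtain ⟨E, hE⟩ := single _ (der_mem_Tker D (c j) (hc j))
  have h1 : (fun t => e (y t)) = (fun l => ⁅e, D⁆ (∑ i, x i l)) + (fun l => E (∑ i, x i l)) := by
    ext t
    rw [Pi.add_apply, Derivation.commutator_apply, hE, hD, he]
    ring
  rw [h1]
  exact Submodule.add_mem _ (M1 _) (M1 _)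

end Gen

section Spread
variable {K : Type*} [Field K] {σ : Type*}

theorem clear_denoms (Q : Ideal (MvPolynomial σ K)) [Q.IsPrime] {S : Type*} [Finite S]
    (w : S → FF Q) : ∃ s : MvPolynomial σ K, s ∉ Q ∧ ∃ r : S → MvPolynomial σ K,
      ∀ i, aeval (gp Q) (r i) = aeval (gp Q) s * w i := by
  obtain ⟨b, hb⟩ := IsLocalization.exist_integer_multiples_of_finite
    (nonZeroDivisors (MvPolynomial σ K ⧸ Q)) w
  obtain ⟨s, hs⟩ := Ideal.Quotient.mk_surjective (b : MvPolynomial σ K ⧸ Q)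
  choose r0 hr0 using hb
  choose r hr using fun i => Ideal.Quotient.mk_surjective (r0 i)
  refine ⟨s, fun h => ?_, r, fun i => ?_⟩
  · rw [Ideal.Quotient.eq_zero_iff_mem.2 h] at hs
    exact nonZeroDivisors.ne_zero b.2 hs.symm
  · rw [aeval_gp', aeval_gp', hr, hr0, hs, Algebra.smul_def]

theorem spread_der [Finite σ] (Q : Ideal (MvPolynomial σ K)) [Q.IsPrime] (e : Derivation K (FF Q) (FF Q)) :
    ∃ s : MvPolynomial σ K, s ∉ Q ∧
    ∃ D : Derivation K (MvPolynomial σ K) (MvPolynomial σ K),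
      ∀ f, aeval (gp Q) (D f) = aeval (gp Q) s * e (aeval (gp Q) f) := by
  obtain ⟨s, hs, r, hr⟩ := clear_denoms Q (fun i => e (gp Q i))
  refine ⟨s, hs, mkDerivation K r, fun f => ?_⟩
  induction f using MvPolynomial.induction_on with
  | C a =>
    have : e (aeval (gp Q) (C a : MvPolynomial σ K)) = 0 := by
      rw [aeval_C]; exact e.map_algebraMap a
    rw [this]; simp
  | add p q hp hq => simp only [map_add, hp, hq, mul_add]
  | mul_X p i hp =>
    have h1 : e (aeval (gp Q) (p * X i)) = aeval (gp Q) p * e (gp Q i) +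
        gp Q i * e (aeval (gp Q) p) := by
      rw [map_mul (aeval (gp Q)), Derivation.leibniz, aeval_X]; rfl
    rw [h1, Derivation.leibniz, mkDerivation_X, map_add, smul_eq_mul,
      smul_eq_mul, map_mul (aeval (gp Q)), map_mul (aeval (gp Q)), hr, hp, aeval_X]
    ring

theorem spread_span [Finite σ] {ι : Type*} [Fintype ι] (Q : Ideal (MvPolynomial σ K)) [Q.IsPrime]
    {S : Type*} [Fintype S] (g : S → ι → MvPolynomial σ K) :
    ∃ s : MvPolynomial σ K, s ∉ Q ∧ ∀ w : ι → MvPolynomial σ K,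
      (fun t => aeval (gp Q) (w t)) ∈
        Submodule.span (FF Q) (Set.range fun i => fun t => aeval (gp Q) (g i t)) →
      ∀ p : σ → K, (∀ f ∈ Q, eval p f = 0) → eval p s ≠ 0 →
        (fun t => eval p (w t)) ∈ Submodule.span K (Set.range fun i => fun t => eval p (g i t)) := by
  classical
  let L : Submodule (MvPolynomial σ K) (ι → MvPolynomial σ K) :=
    { carrier := {w | (fun t => aeval (gp Q) (w t)) ∈
        Submodule.span (FF Q) (Set.range fun i => fun t => aeval (gp Q) (g i t))}
      add_mem' := fun {a b} ha hb => by
        have : (fun t => aeval (gp Q) ((a + b) t)) = (fun t => aeval (gp Q) (a t)) +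
          (fun t => aeval (gp Q) (b t)) := by ext t; simp
        rw [Set.mem_setOf_eq, this]
        exact Submodule.add_mem _ ha hb
      zero_mem' := by
        have : (fun t => aeval (gp Q) ((0 : ι → MvPolynomial σ K) t)) = 0 := by ext t; simp
        rw [Set.mem_setOf_eq, this]
        exact Submodule.zero_mem _
      smul_mem' := fun c a ha => by
        have : (fun t => aeval (gp Q) ((c • a) t)) = (aeval (gp Q) c) • (fun t => aeval (gp Q) (a t)) := by
          ext t; simp
        rw [Set.mem_setOf_eq, this]
        exact Submodule.smul_mem _ _ ha }
  have hL : L.FG := IsNoetherian.noetherian L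
  obtain ⟨G, hG⟩ := hL
  have one : ∀ w ∈ L, ∃ s : MvPolynomial σ K, s ∉ Q ∧
      ∀ p : σ → K, (∀ f ∈ Q, eval p f = 0) → eval p s ≠ 0 →
        (fun t => eval p (w t)) ∈ Submodule.span K (Set.range fun i => fun t => eval p (g i t)) := by
    intro w hw
    obtain ⟨c, hc⟩ := (Submodule.mem_span_range_iff_exists_fun _).1 hw
    obtain ⟨s, hs, r, hr⟩ := clear_denoms Q c
    refine ⟨s, hs, fun p hp hsp => ?_⟩
    have h1 : ∀ t, s * w t - ∑ i, r i * g i t ∈ Q := fun t => by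
      rw [← aeval_gp, map_sub, map_mul, map_sum]
      have := congrFun hc t
      simp only [Finset.sum_apply, Pi.smul_apply, smul_eq_mul] at this
      rw [← this, Finset.mul_sum, sub_eq_zero]
      exact Finset.sum_congr rfl fun i _ => by rw [map_mul, hr]; ring
    rw [Submodule.mem_span_range_iff_exists_fun]
    refine ⟨fun i => (eval p s)⁻¹ * eval p (r i), ?_⟩
    ext t
    have h2 := hp _ (h1 t)
    rw [map_sub, map_mul, map_sum, sub_eq_zero] at h2
    simp only [Finset.sum_apply, Pi.smul_apply, smul_eq_mul]
    rw [← mul_right_inj' hsp, h2, Finset.mul_sum]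
    exact Finset.sum_congr rfl fun i _ => by rw [map_mul]; field_simp
  have hGL : ∀ w ∈ G, w ∈ L := fun w hw => by rw [← hG]; exact Submodule.subset_span hw
  choose s hs hs' using one
  refine ⟨∏ w : G, s w.1 (hGL w.1 w.2), ?_, fun w hw p hp hsp => ?_⟩
  · rw [Ideal.IsPrime.prod_mem_iff]
    rintro ⟨w, -, hw⟩
    exact hs _ _ hw
  · rw [map_prod, Finset.prod_ne_zero_iff] at hsp
    have hwL : w ∈ Submodule.span (MvPolynomial σ K) (G : Set (ι → MvPolynomial σ K)) := by
      rw [hG]; exact hw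
    clear hw
    induction hwL using Submodule.span_induction with
    | mem w hw => exact hs' w (hGL w hw) p hp (hsp ⟨w, hw⟩ (Finset.mem_univ _))
    | zero =>
      have : (fun t => eval p ((0 : ι → MvPolynomial σ K) t)) = 0 := by ext t; simp
      rw [this]; exact Submodule.zero_mem _
    | add a b _ _ ha hb =>
      have : (fun t => eval p ((a + b) t)) = (fun t => eval p (a t)) + (fun t => eval p (b t)) := by
        ext t; simp
      rw [this]; exact Submodule.add_mem _ ha hb
    | smul c a _ ha =>
      have : (fun t => eval p ((c • a) t)) = (eval p c) • (fun t => eval p (a t)) := by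
        ext t; simp
      rw [this]; exact Submodule.smul_mem _ _ ha

theorem leibniz_iter {A : Type*} [CommRing A] [Algebra K A] (D : Derivation K A A) (f g : A) (m : ℕ) :
    D^[m] (f * g) = ∑ ij ∈ Finset.HasAntidiagonal.antidiagonal m, (m.choose ij.1 : A) * (D^[ij.1] f * D^[ij.2] g) := by
  induction m with
  | zero => simp
  | succ m ih =>
    rw [Function.iterate_succ_apply', ih,
      Finset.sum_antidiagonal_choose_succ_mul (fun i j => D^[i] f * D^[j] g), map_sum,
      ← Finset.sum_add_distrib]
    refine Finset.sum_congr rfl fun ij hij => ?_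
    have h1 : m.choose ij.2 = m.choose ij.1 := by
      rw [Finset.HasAntidiagonal.mem_antidiagonal] at hij
      rw [← hij, add_comm, Nat.choose_symm_add]
    rw [h1, Function.iterate_succ_apply', Function.iterate_succ_apply', Derivation.leibniz,
      Derivation.leibniz]
    have : D (m.choose ij.1 : A) = 0 := D.map_natCast _
    rw [this]
    simp only [smul_eq_mul]
    ring

/-- functions vanishing to infinite order along the flow -/
def jetIdeal (p : σ → K) (D : Derivation K (MvPolynomial σ K) (MvPolynomial σ K)) :
    Ideal (MvPolynomial σ K) where
  carrier := {f | ∀ m, eval p (D^[m] f) = 0}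
  add_mem' := fun {a b} ha hb m => by
    rw [iterate_map_add, map_add, ha m, hb m, add_zero]
  zero_mem' := fun m => by rw [iterate_map_zero, map_zero]
  smul_mem' := fun c f hf m => by
    rw [smul_eq_mul, leibniz_iter, map_sum]
    exact Finset.sum_eq_zero fun ij _ => by rw [map_mul, map_mul, hf ij.2, mul_zero, mul_zero]

theorem jetIdeal_prime [CharZero K] (p : σ → K)
    (D : Derivation K (MvPolynomial σ K) (MvPolynomial σ K)) : (jetIdeal p D).IsPrime := by
  classical
  refine ⟨?_, fun {f g} hfg => ?_⟩
  · rw [Ideal.ne_top_iff_one]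
    intro h
    have := h 0
    simp at this
  · by_contra hcon
    push Not at hcon
    obtain ⟨hf, hg⟩ := hcon
    have hf' : ∃ m, eval p (D^[m] f) ≠ 0 := by
      by_contra h; push Not at h; exact hf h
    have hg' : ∃ m, eval p (D^[m] g) ≠ 0 := by
      by_contra h; push Not at h; exact hg h
    have h1 := hfg (Nat.find hf' + Nat.find hg')
    rw [leibniz_iter, map_sum, Finset.sum_eq_single (Nat.find hf', Nat.find hg')] at h1
    · rw [map_mul, map_mul, map_natCast] at h1
      have h2 : ((Nat.find hf' + Nat.find hg').choose (Nat.find hf') : K) ≠ 0 := by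
        rw [Nat.cast_ne_zero]
        exact (Nat.choose_pos (Nat.le_add_right _ _)).ne'
      exact mul_ne_zero h2 (mul_ne_zero (Nat.find_spec hf') (Nat.find_spec hg')) h1
    · rintro ⟨i, j⟩ hij hne
      rw [Finset.HasAntidiagonal.mem_antidiagonal] at hij
      simp only at hij
      rw [map_mul, map_mul]
      by_cases hi : i < Nat.find hf'
      · have := not_not.1 (Nat.find_min hf' hi)
        rw [this]; simp
      · have hj : j < Nat.find hg' := by
          by_contra hj
          apply hne
          ext <;> simp <;> omega
        have := not_not.1 (Nat.find_min hg' hj)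
        rw [this]; simp
    · intro h
      simp at h

theorem le_jetIdeal {Q : Ideal (MvPolynomial σ K)} {p : σ → K} (hp : ∀ f ∈ Q, eval p f = 0)
    {D : Derivation K (MvPolynomial σ K) (MvPolynomial σ K)} (hD : ∀ f ∈ Q, D f ∈ Q) :
    Q ≤ jetIdeal p D := by
  intro f hf m
  apply hp
  induction m with
  | zero => exact hf
  | succ m ih => rw [Function.iterate_succ_apply']; exact hD _ ih

end Spread

section Irr
variable {K : Type*} [Field K] {ι : Type*} [Fintype ι]

theorem nullst [IsAlgClosed K] (P : Ideal (MvPolynomial ι K)) [P.IsPrime] (f : MvPolynomial ι K)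
    (h : ∀ v, (∀ g ∈ P, eval v g = 0) → eval v f = 0) : f ∈ P := by
  rw [← MvPolynomial.IsPrime.vanishingIdeal_zeroLocus (K := K) P]
  intro v hv
  exact h v hv

/-- projective image of a principal open subset of an affine variety -/
def imgOpen (P : Ideal (MvPolynomial ι K)) (g0 : MvPolynomial ι K) : Set (PP K ι) :=
  {u | ∃ v ∈ u.submodule, v ≠ 0 ∧ (∀ f ∈ P, eval v f = 0) ∧ eval v g0 ≠ 0}

theorem imgOpen_irred [IsAlgClosed K] (P : Ideal (MvPolynomial ι K)) [P.IsPrime] (g0 : MvPolynomial ι K)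
    (h0 : ∀ v, eval v g0 ≠ 0 → v ≠ 0) (hg0 : g0 ∉ P) (hne : (imgOpen P g0).Nonempty) :
    IsZIrreducible (imgOpen P g0) := by
  refine ⟨hne, ?_⟩
  rintro _ _ ⟨S, hS, rfl⟩ ⟨T, hT, rfl⟩ hST
  by_contra hcon
  push Not at hcon
  obtain ⟨h1, h2⟩ := hcon
  have key : ∀ S : Set (MvPolynomial ι K), (∀ f ∈ S, ∃ d : ℕ, f.IsHomogeneous d) →
      ¬ imgOpen P g0 ⊆ zeroLocus S → ∃ f ∈ S, f ∉ P := by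
    intro S hS h
    rw [Set.not_subset] at h
    obtain ⟨u, ⟨v, hv, hv0, hvP, hvg⟩, hu⟩ := h
    simp only [zeroLocus, Set.mem_setOf_eq, not_forall] at hu
    obtain ⟨f, hf, w, hw, hfw⟩ := hu
    refine ⟨f, hf, fun hfP => hfw ?_⟩
    obtain ⟨d, hd⟩ := hS f hf
    have : ∃ c : K, w = c • v := by
      obtain ⟨a, ha⟩ := mem_submodule_iff.1 hv
      obtain ⟨b, hb⟩ := mem_submodule_iff.1 hw
      have ha0 : a ≠ 0 := fun h => hv0 (by rw [ha, h, zero_smul])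
      exact ⟨b * a⁻¹, by rw [ha, hb, smul_smul, mul_assoc, inv_mul_cancel₀ ha0, mul_one]⟩
    obtain ⟨c, rfl⟩ := this
    have h3 := aeval_smul_hom f d hd v c
    simp only [coe_aeval_eq_eval, aeval_eq_eval] at h3
    rw [h3, hvP f hfP, mul_zero]
  obtain ⟨f, hf, hfP⟩ := key S hS h1
  obtain ⟨g, hg, hgP⟩ := key T hT h2
  have : f * g * g0 ∈ P := by
    refine nullst P _ fun v hv => ?_
    by_cases hvg : eval v g0 = 0
    · rw [map_mul, hvg, mul_zero]
    · have hv0 := h0 v hvg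
      rcases hST ⟨v, mem_submodule_mk hv0, hv0, hv, hvg⟩ with h | h
      · rw [map_mul, map_mul, h f hf v (mem_submodule_mk hv0)]; simp
      · rw [map_mul, map_mul, h g hg v (mem_submodule_mk hv0)]; simp
  have hPp : P.IsPrime := inferInstance
  rcases hPp.mem_or_mem this with h | h
  · exact (hPp.mem_or_mem h).elim hfP hgP
  · exact hg0 h

theorem exists_component {S Z : Set (PP K ι)} (hZ : IsZIrreducible Z) (hZS : Z ⊆ S) :
    ∃ C, IsZIrredComponent S C ∧ Z ⊆ C := by
  obtain ⟨C, hC, hm⟩ := zorn_subset_nonempty {C | IsZIrreducible C ∧ C ⊆ S} (by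
    intro c hc hch hcne
    refine ⟨⋃₀ c, ⟨⟨?_, ?_⟩, Set.sUnion_subset fun s hs => (hc hs).2⟩,
      fun s hs => Set.subset_sUnion_of_mem hs⟩
    · obtain ⟨s, hs⟩ := hcne
      obtain ⟨x, hx⟩ := (hc hs).1.1
      exact ⟨x, s, hs, hx⟩
    · intro Y W hY hW hYW
      by_contra hcon
      push Not at hcon
      obtain ⟨h1, h2⟩ := hcon
      rw [Set.sUnion_subset_iff] at h1 h2
      push Not at h1 h2
      obtain ⟨s, hs, hsY⟩ := h1
      obtain ⟨t, ht, htW⟩ := h2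
      rcases hch.total hs ht with h | h
      · rcases (hc ht).1.2 Y W hY hW ((Set.subset_sUnion_of_mem ht).trans hYW) with h' | h'
        · exact hsY (h.trans h')
        · exact htW h'
      · rcases (hc hs).1.2 Y W hY hW ((Set.subset_sUnion_of_mem hs).trans hYW) with h' | h'
        · exact hsY h'
        · exact htW (h.trans h')) Z ⟨hZ, hZS⟩
  refine ⟨C, ⟨hm.1.1, hm.1.2, fun D hD hDS hCD => ?_⟩, hC⟩
  exact Set.Subset.antisymm hCD (hm.2 ⟨hD, hDS⟩ hCD)

end Irr

section Point
variable {K : Type*} [Field K] [IsAlgClosed K] [CharZero K] {ι : Type*} [Fintype ι]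

theorem mem_of_VI {X : Set (PP K ι)} (hX : IsZClosed X) {u : PP K ι} {v : ι → K} (hv : v ∈ u.submodule)
    (hv0 : v ≠ 0) (h : ∀ f ∈ VI (coneOf X), eval v f = 0) : u ∈ X := by
  obtain ⟨S, hS, rfl⟩ := hX
  intro f hf w hw
  obtain ⟨d, hd⟩ := hS f hf
  have hfv : eval v f = 0 := h f (by
    intro y hy
    obtain ⟨x, hx, hy⟩ := mem_coneOf.1 hy
    exact hx f hf y hy)
  have : ∃ c : K, w = c • v := by
    obtain ⟨a, ha⟩ := mem_submodule_iff.1 hv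
    obtain ⟨b, hb⟩ := mem_submodule_iff.1 hw
    have ha0 : a ≠ 0 := fun h => hv0 (by rw [ha, h, zero_smul])
    exact ⟨b * a⁻¹, by rw [ha, hb, smul_smul, mul_assoc, inv_mul_cancel₀ ha0, mul_one]⟩
  obtain ⟨c, rfl⟩ := this
  have h3 := aeval_smul_hom f d hd v c
  simp only [coe_aeval_eq_eval, aeval_eq_eval] at h3
  rw [h3, hfv, mul_zero]

theorem img_subset [DecidableEq ι] {X : Set (PP K ι)} (hX : IsZClosed X) (n : ℕ)
    (hn : zdim X = ((n : ℕ∞) : WithBot ℕ∞)) {δ : MvPolynomial ι K} {B : ι → ι → MvPolynomial ι K}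
    (hB : IsB (VI (coneOf X)) (n + 1) δ B) (Z : Ideal (MvPolynomial ι K)) [Z.IsPrime]
    (hZ : VI (coneOf X) ≤ Z) (A : Set (PP K ι)) (u0 : PP K ι) (hu0 : u0 ∈ A) (a : ι → K)
    (ha : a ∈ u0.submodule) (haZ : ∀ f ∈ Z, eval a f = 0) (haδ : eval a δ ≠ 0) (l0 : ι) (hl0 : a l0 ≠ 0)
    (W : Submodule K (ι → K)) (hW : W ≤ vspan (⋃ a ∈ A, embTangentSpace X a))
    (hWB : ∀ (l : ι) (h : ι → K), (∀ w ∈ W, ∑ i, h i * w i = 0) → ∑ t, C (h t) * B t l ∈ Z) :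
    imgOpen Z (δ * MvPolynomial.X l0) ⊆ contactLocus X A := by
  haveI : Infinite K := inferInstance
  have hsub : imgOpen Z (δ * MvPolynomial.X l0) ⊆ tangencyLocus X A := by
    rintro u ⟨v, hvu, hv0, hvZ, hvg⟩
    have hvP : ∀ f ∈ VI (coneOf X), aeval v f = 0 := fun f hf => hvZ f (hZ hf)
    rw [map_mul] at hvg
    have hvδ : aeval v δ ≠ 0 := left_ne_zero_of_mul hvg
    have hT := Tker_eq_rep (X := X) hv0 hvu
    refine ⟨⟨mem_of_VI hX hvu hv0 hvP, ?_⟩, ?_⟩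
    · rw [embTangentSpace_eq, hn, zdim_PS_iff, hT]
      exact hB.finrank hvP hvδ
    · rw [embTangentSpace_eq, hT]
      intro y hy
      refine le_trans hy (le_trans ?_ hW)
      intro w hw
      have hcol : ∀ l, (fun t => aeval v (B t l)) ∈ W := fun l => by
        by_contra hnot
        obtain ⟨h, h1, h2⟩ := exists_form W hnot
        apply h2
        have h3 := hvZ _ (hWB l h h1)
        rw [map_sum] at h3
        simpa using h3
      have : w = ∑ l, ((aeval v δ)⁻¹ * w l) • (fun t => aeval v (B t l)) := by
        ext t
        rw [Finset.sum_apply]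
        simp only [Pi.smul_apply, smul_eq_mul]
        rw [← mul_right_inj' hvδ, ← hB.mul_eq hw t, Finset.mul_sum]
        refine Finset.sum_congr rfl fun l _ => ?_
        field_simp
      rw [this]
      exact Submodule.sum_mem _ fun l _ => Submodule.smul_mem _ _ (hcol l)
  have ha0 : a ≠ 0 := fun h => hl0 (by rw [h]; rfl)
  have hg0 : eval a (δ * MvPolynomial.X l0) ≠ 0 := by
    rw [map_mul, eval_X]; exact mul_ne_zero haδ hl0
  have hmem : u0 ∈ imgOpen Z (δ * MvPolynomial.X l0) := ⟨a, ha, ha0, haZ, hg0⟩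
  have hirr := imgOpen_irred Z (δ * MvPolynomial.X l0) (fun v hv h => by
    rw [map_mul, eval_X, h] at hv; simp at hv) (fun h => hg0 (haZ _ h)) ⟨u0, hmem⟩
  obtain ⟨C, hC, hZC⟩ := exists_component hirr hsub
  refine (hZC.trans ?_).trans (subset_zclosure _)
  exact Set.subset_biUnion_of_mem (u := fun C => C) (show C ∈ {C : Set (PP K ι) |
    IsZIrredComponent (tangencyLocus X A) C ∧ (C ∩ A).Nonempty} from ⟨hC, u0, hZC hmem, hu0⟩)

theorem point_lemma [DecidableEq ι] {X : Set (PP K ι)} (hX : IsZClosed X) (n k : ℕ)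
    (hn : zdim X = ((n : ℕ∞) : WithBot ℕ∞)) {δ : MvPolynomial ι K} {B : ι → ι → MvPolynomial ι K}
    (hB : IsB (VI (coneOf X)) (n + 1) δ B) (Q : Ideal (MvPolynomial ((Fin k ⊕ Fin k) × ι) K)) [Q.IsPrime]
    (hQ : ∀ i, ∀ f ∈ VI (coneOf X), rename (fun l => (Sum.inl i, l)) f ∈ Q)
    (e : Derivation K (FF Q) (FF Q)) (j : Fin k)
    (he : ∀ l, ∑ i, e (gp Q (Sum.inl i, l)) = gp Q (Sum.inr j, l))
    (heM : ∀ y ∈ Mspan B (fun (i : Fin k) l => gp Q (Sum.inl i, l)),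
      (fun t => e (y t)) ∈ Mspan B (fun (i : Fin k) l => gp Q (Sum.inl i, l)))
    (s : MvPolynomial ((Fin k ⊕ Fin k) × ι) K)
    (D : Derivation K (MvPolynomial ((Fin k ⊕ Fin k) × ι) K) (MvPolynomial ((Fin k ⊕ Fin k) × ι) K))
    (hD : ∀ f, aeval (gp Q) (D f) = aeval (gp Q) s * e (aeval (gp Q) f))
    (p : (Fin k ⊕ Fin k) × ι → K) (hp : ∀ f ∈ Q, eval p f = 0) (hs : eval p s ≠ 0)
    (hsp : ∀ w : ι → MvPolynomial ((Fin k ⊕ Fin k) × ι) K,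
      (fun t => aeval (gp Q) (w t)) ∈ Mspan B (fun (i : Fin k) l => gp Q (Sum.inl i, l)) →
        (fun t => eval p (w t)) ∈ Submodule.span K (Set.range fun q : Fin k × ι =>
          fun t => eval (fun l => p (Sum.inl q.1, l)) (B t q.2)))
    (hδ : ∀ i, eval (fun l => p (Sum.inl i, l)) δ ≠ 0) (l0 : Fin k → ι)
    (hl0 : ∀ i, p (Sum.inl i, l0 i) ≠ 0) (u : Fin k → PP K ι)
    (hu : ∀ i, (fun l => p (Sum.inl i, l)) ∈ (u i).submodule) :
    (fun l => p (Sum.inr j, l)) ∈ vspan (contactLocus X (Set.range u)) := by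
  haveI : Infinite K := inferInstance
  haveI hJ := jetIdeal_prime p D
  have hQD : ∀ f ∈ Q, D f ∈ Q := fun f hf => by
    rw [← aeval_gp, hD, (aeval_gp Q f).2 hf, map_zero, mul_zero]
  have hQJ := le_jetIdeal hp hQD
  set W : Submodule K (ι → K) := Submodule.span K (Set.range fun q : Fin k × ι =>
          fun t => eval (fun l => p (Sum.inl q.1, l)) (B t q.2)) with hWdef
  -- the ideals of the arcs
  let Zi : Fin k → Ideal (MvPolynomial ι K) := fun i =>
    (jetIdeal p D).comap (rename (R := K) (fun l : ι => ((Sum.inl i, l) : (Fin k ⊕ Fin k) × ι)))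
  haveI hZi : ∀ i, (Zi i).IsPrime := fun i => Ideal.IsPrime.comap _
  have haP : ∀ i, ∀ f ∈ VI (coneOf X), aeval (fun l => p (Sum.inl i, l)) f = 0 := fun i f hf => by
    have := hp _ (hQ i f hf)
    rw [eval_rename] at this
    exact this
  have hW : W ≤ vspan (⋃ a ∈ Set.range u, embTangentSpace X a) := by
    rw [hWdef, Submodule.span_le]
    rintro _ ⟨⟨i, l⟩, rfl⟩
    have h1 := hB.col_mem (haP i) l
    have ha0 : (fun l => p (Sum.inl i, l)) ≠ 0 := fun h => hl0 i (congrFun h (l0 i))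
    rw [← Tker_eq_rep (X := X) ha0 (hu i)] at h1
    by_cases hz : (fun t => aeval (fun l => p (Sum.inl i, l)) (B t l)) = 0
    · have hz' : (fun t => eval (fun l => p (Sum.inl i, l)) (B t l)) = 0 := hz
      simp only [hz']
      exact Submodule.zero_mem _
    apply Submodule.subset_span
    refine coneOf_mono (Set.subset_biUnion_of_mem (u := fun a => embTangentSpace X a)
      (show u i ∈ Set.range u from ⟨i, rfl⟩)) ?_
    simp only
    rw [embTangentSpace_eq]
    exact (mem_coneOf_PS hz).2 h1
  have hkey : ∀ i, imgOpen (Zi i) (δ * MvPolynomial.X (l0 i)) ⊆ contactLocus X (Set.range u) := by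
    intro i
    refine img_subset hX n hn hB (Zi i) (fun f hf => hQJ (hQ i f hf)) (Set.range u) (u i) ⟨i, rfl⟩
      (fun l => p (Sum.inl i, l)) (hu i) (fun f hf => ?_) (hδ i) (l0 i) (hl0 i) W hW ?_
    · have := hf 0
      rw [Function.iterate_zero_apply, eval_rename] at this
      exact this
    · intro l h hh m
      have hw : ∀ m, (fun t => aeval (gp Q) (D^[m] (rename (fun l : ι =>
          ((Sum.inl i, l) : (Fin k ⊕ Fin k) × ι)) (B t l)))) ∈
          Mspan B (fun (i : Fin k) l => gp Q (Sum.inl i, l)) := by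
        intro m
        induction m with
        | zero =>
          simp only [Function.iterate_zero_apply, aeval_rename]
          exact Submodule.subset_span ⟨(i, l), rfl⟩
        | succ m ih =>
          have h1 : (fun t => aeval (gp Q) (D^[m + 1] (rename (fun l : ι =>
            ((Sum.inl i, l) : (Fin k ⊕ Fin k) × ι)) (B t l)))) = aeval (gp Q) s • (fun t => e (aeval (gp Q) (D^[m] (rename (fun l : ι =>
            ((Sum.inl i, l) : (Fin k ⊕ Fin k) × ι)) (B t l))))) := by
            ext t
            rw [Function.iterate_succ_apply', hD]; rfl
          rw [h1]
          exact Submodule.smul_mem _ _ (heM _ ih)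
      have h2 := hh _ (hsp _ (hw m))
      rw [map_sum]
      have h3 : D^[m] (∑ t, rename (fun l : ι => ((Sum.inl i, l) : (Fin k ⊕ Fin k) × ι)) (C (h t) * B t l))
          = ∑ t, C (h t) * D^[m] (rename (fun l : ι => ((Sum.inl i, l) : (Fin k ⊕ Fin k) × ι)) (B t l)) := by
        clear h2 hw
        induction m with
        | zero => simp [rename_C]
        | succ m ih =>
          rw [Function.iterate_succ_apply', ih, map_sum]
          refine Finset.sum_congr rfl fun t _ => ?_
          rw [Function.iterate_succ_apply', ← smul_eq_C_mul, ← smul_eq_C_mul, D.map_smul]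
      rw [h3, map_sum, ← h2]
      exact Finset.sum_congr rfl fun t _ => by rw [map_mul, eval_C]
  by_contra hnot
  obtain ⟨h, h1, h2⟩ := exists_form _ hnot
  apply h2
  have hlin : ∀ i, linPoly h ∈ Zi i := by
    intro i
    have h3 : linPoly h * (δ * MvPolynomial.X (l0 i)) ∈ Zi i := by
      refine nullst _ _ fun v hv => ?_
      by_cases hg : eval v (δ * MvPolynomial.X (l0 i)) = 0
      · rw [map_mul, hg, mul_zero]
      · have hv0 : v ≠ 0 := fun h => by
          rw [map_mul, eval_X, h] at hg; simp at hg
        have := hkey i ⟨v, mem_submodule_mk hv0, hv0, hv, hg⟩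
        rw [map_mul, eval_linPoly, h1 v (Submodule.subset_span (mem_coneOf.2 ⟨_, this, mem_submodule_mk hv0⟩)),
          zero_mul]
    rcases (hZi i).mem_or_mem h3 with h4 | h4
    · exact h4
    · exfalso
      have := h4 0
      rw [Function.iterate_zero_apply, eval_rename, map_mul, eval_X] at this
      exact mul_ne_zero (hδ i) (hl0 i) this
  have h5 : ∑ i, D (rename (fun l : ι => ((Sum.inl i, l) : (Fin k ⊕ Fin k) × ι)) (linPoly h)) -
      s * rename (fun l : ι => ((Sum.inr j, l) : (Fin k ⊕ Fin k) × ι)) (linPoly h) ∈ Q := by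
    have hl : ∀ z : ι → FF Q, aeval z (linPoly h) = ∑ l, h l • z l := fun z => by
      rw [linPoly, map_sum]
      exact Finset.sum_congr rfl fun l _ => by
        rw [map_mul, aeval_C, aeval_X, Algebra.smul_def]
    rw [← aeval_gp, map_sub, map_sum, sub_eq_zero, map_mul]
    simp only [hD, aeval_rename, hl, Function.comp_def]
    rw [← Finset.mul_sum]
    congr 1
    simp only [map_sum, Derivation.map_smul]
    rw [Finset.sum_comm]
    exact Finset.sum_congr rfl fun l _ => by rw [← Finset.smul_sum, he]
  have h6 := hp _ h5
  have h7 : ∀ i, eval p (D (rename (fun l : ι => ((Sum.inl i, l) : (Fin k ⊕ Fin k) × ι)) (linPoly h))) = 0 :=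
    fun i => hlin i 1
  rw [map_sub, map_sum, Finset.sum_eq_zero (fun i _ => h7 i), zero_sub, neg_eq_zero, map_mul,
    eval_rename, eval_linPoly] at h6
  exact (mul_eq_zero.1 h6).resolve_left hs

end Point

section Local
variable {K : Type*} [Field K] [IsAlgClosed K] [CharZero K] {ι : Type*} [Fintype ι]

theorem local_claim [DecidableEq ι] {X : Set (PP K ι)} (hX : IsIntegralVariety X) (n k m : ℕ) (hkm : k ≤ m)
    (hm : 1 ≤ m) (hn : zdim X = ((n : ℕ∞) : WithBot ℕ∞)) {δ : MvPolynomial ι K}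
    {B : ι → ι → MvPolynomial ι K}
    (hB : IsB (VI (coneOf X)) (n + 1) δ B)
    (hgp : ∀ h : (VI (coneOf X)).IsPrime, rk K (Set.range (gp (VI (coneOf X)))) = ((n + 1 : ℕ) : ℕ∞))
    (hsec : zdim (secant m X) = (((m * (n + 1) - 1 : ℕ) : ℕ∞) : WithBot ℕ∞))
    (Q : Ideal (MvPolynomial ((Fin k ⊕ Fin k) × ι) K)) (hQp : Q.IsPrime)
    (hQl : ∀ i : Fin k, ∀ f ∈ VI (coneOf X), rename (fun l => (Sum.inl i, l)) f ∈ Q)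
    (hQr : ∀ i : Fin k, ∀ f ∈ VI (coneOf X), rename (fun l => (Sum.inr i, l)) f ∈ Q)
    (hQs : ∀ l, ∑ i : Fin k, MvPolynomial.X (Sum.inl i, l) - ∑ i : Fin k, MvPolynomial.X (Sum.inr i, l) ∈ Q) :
    ∃ G : MvPolynomial (Fin k × ι) K, G ∉ VI (CM (Fin k) X) ∧
      ∀ p : (Fin k ⊕ Fin k) × ι → K, (∀ f ∈ Q, eval p f = 0) →
        eval (fun q => p (Sum.inl q.1, q.2)) G ≠ 0 →
        ∀ j, (fun l => p (Sum.inr j, l)) ≠ 0 ∧ ∀ u : Fin k → PP K ι,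
          (∀ i, (fun l => p (Sum.inl i, l)) ∈ (u i).submodule) →
          (fun l => p (Sum.inr j, l)) ∈ vspan (contactLocus X (Set.range u)) := by
  haveI : Infinite K := inferInstance
  haveI hP := prime_of_irred hX.2
  set g : Fin k × ι → (Fin k ⊕ Fin k) × ι := fun q => (Sum.inl q.1, q.2) with hg
  by_cases hcase : ∃ G, G ∉ VI (CM (Fin k) X) ∧ rename g G ∈ Q
  · obtain ⟨G, h1, h2⟩ := hcase
    refine ⟨G, h1, fun p hp hG => absurd ?_ hG⟩
    have := hp _ h2
    rwa [eval_rename] at this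
  push Not at hcase
  have hker : ∀ F : MvPolynomial (Fin k × ι) K, aeval (gp Q ∘ g) F = 0 → F ∈ VI (CM (Fin k) X) := fun F hF => by
    by_contra hcon
    refine hcase F hcon ?_
    rw [← aeval_gp, aeval_rename, hF]
  have hr := sec_rk hX.2 n k m hkm hm hgp hsec (fun i l => gp Q (Sum.inl i, l)) hker
  have hxP : ∀ i : Fin k, ∀ f ∈ VI (coneOf X), aeval (fun l => gp Q (Sum.inl i, l)) f = 0 := fun i f hf => by
    have := (aeval_gp Q _).2 (hQl i f hf)
    rwa [aeval_rename] at this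
  have hcP : ∀ i : Fin k, ∀ f ∈ VI (coneOf X), aeval (fun l => gp Q (Sum.inr i, l)) f = 0 := fun i f hf => by
    have := (aeval_gp Q _).2 (hQr i f hf)
    rwa [aeval_rename] at this
  obtain ⟨hxg, hcg, hcl, hder⟩ := generic_main hB (hgp hP) (fun z hz => euler_mem z hz)
    (fun (i : Fin k) l => gp Q (Sum.inl i, l)) (fun i l => gp Q (Sum.inr i, l)) hxP hcP
    (fun l => by
      have := (aeval_gp Q _).2 (hQs l)
      rw [map_sub, map_sum, map_sum, sub_eq_zero] at this
      simpa only [aeval_X] using this) hr (by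
      rw [← closure_gp Q]
      congr 1
      ext y
      constructor
      · rintro (⟨q, rfl⟩ | ⟨q, rfl⟩)
        · exact ⟨_, rfl⟩
        · exact ⟨_, rfl⟩
      · rintro ⟨⟨i | i, l⟩, rfl⟩
        · exact Or.inl ⟨(i, l), rfl⟩
        · exact Or.inr ⟨(i, l), rfl⟩)
  -- a coordinate not vanishing on `X`
  obtain ⟨l0, hl0⟩ : ∃ l, (MvPolynomial.X l : MvPolynomial ι K) ∉ VI (coneOf X) := by
    by_contra hcon
    push Not at hcon
    obtain ⟨x, hx⟩ := hX.2.1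
    apply x.rep_nonzero
    ext l
    have := hcon l _ (mem_coneOf.2 ⟨x, hx, rep_mem x⟩)
    simpa using this
  choose e he heM using hder
  choose s hs D hD using fun j => spread_der Q (e j)
  obtain ⟨Δ, hΔ, hΔs⟩ := spread_span Q (fun (q : Fin k × ι) (t : ι) =>
    rename (fun l : ι => ((Sum.inl q.1, l) : (Fin k ⊕ Fin k) × ι)) (B t q.2))
  set s' : MvPolynomial ((Fin k ⊕ Fin k) × ι) K := Δ * (∏ j, s j) *
    (∏ i : Fin k, rename (fun l : ι => ((Sum.inl i, l) : (Fin k ⊕ Fin k) × ι)) δ) *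
    (∏ i : Fin k, MvPolynomial.X (Sum.inl i, l0)) * (∏ i : Fin k, MvPolynomial.X (Sum.inr i, l0)) with hs'
  have hx0 : ∀ i : Fin k, gp Q (Sum.inl i, l0) ≠ 0 := fun i h => hl0 (hxg i _ (by rw [aeval_X]; exact h))
  have hc0 : ∀ i : Fin k, gp Q (Sum.inr i, l0) ≠ 0 := fun i h => hl0 (hcg i _ (by rw [aeval_X]; exact h))
  have hs'0 : aeval (gp Q) s' ≠ 0 := by
    rw [hs']
    simp only [map_mul, map_prod, aeval_X]
    refine mul_ne_zero (mul_ne_zero (mul_ne_zero (mul_ne_zero ?_ ?_) ?_) ?_) ?_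
    · rwa [Ne, aeval_gp]
    · exact Finset.prod_ne_zero_iff.2 fun j _ => by rw [Ne, aeval_gp]; exact hs j
    · refine Finset.prod_ne_zero_iff.2 fun i _ => ?_
      rw [aeval_rename]
      exact fun h => hB.hδ (hxg i _ h)
    · exact Finset.prod_ne_zero_iff.2 fun j _ => hx0 j
    · exact Finset.prod_ne_zero_iff.2 fun j _ => hc0 j
  obtain ⟨G, ps, hG0, hGs⟩ := exists_dvd_poly (gp Q) g s' hs'0 (by
    rw [← mem_closure_iff]
    have : (Set.range (gp Q ∘ g)) = Set.range fun q : Fin k × ι => gp Q (Sum.inl q.1, q.2) := rfl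
    rw [this, hcl]; trivial)
  have hGQ := (aeval_gp Q _).1 hGs
  refine ⟨G, fun hGV => ?_, fun p hp hGp => ?_⟩
  · -- compare with the generic point of `CM`
    haveI hV : (VI (CM (Fin k) X)).IsPrime := CM_prime hP hX.2.1
    apply hG0
    refine ker_of_rk_le (gp Q ∘ g) (gp (VI (CM (Fin k) X)))
      (fun F hF => (aeval_gp _ _).2 (hker F hF)) (rk_finite _) ?_ G ((aeval_gp _ _).2 hGV)
    have h1 := rk_iUnion_le (K := K) (fun (i : Fin k) l => gp Q (Sum.inl i, l)) (n + 1) (fun i => by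
      rw [← hgp hP]
      exact rk_le_of_ker _ _ fun f hf => hxP i f ((aeval_gp _ f).1 hf))
    rw [Fintype.card_fin] at h1
    have h2 := sec_rk hX.2 n k m hkm hm hgp hsec (fun i l => gp (VI (CM (Fin k) X)) (i, l))
      (fun F hF => (aeval_gp _ _).1 hF)
    refine (h1.trans h2).trans (rk_le_of_adjoin _ _ ?_)
    rintro _ ⟨l, rfl⟩
    exact Subalgebra.sum_mem _ fun i _ => Algebra.subset_adjoin ⟨(i, l), rfl⟩
  · have h1 := hp _ hGQ
    rw [map_sub, eval_rename, map_mul, sub_eq_zero] at h1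
    have h2 : eval p s' ≠ 0 := fun h => hGp (by
      have h3 : eval (p ∘ g) G = 0 := by rw [h1, h, zero_mul]
      exact h3)
    rw [hs'] at h2
    simp only [map_mul, map_prod, eval_X, eval_rename, mul_ne_zero_iff, Finset.prod_ne_zero_iff] at h2
    obtain ⟨⟨⟨⟨h3, h4⟩, h5⟩, h6⟩, h7⟩ := h2
    intro j
    refine ⟨fun h => h7 j (Finset.mem_univ _) (congrFun h l0), fun u hu => ?_⟩
    refine point_lemma hX.1 n k hn hB Q hQl (e j) j (he j) (heM j) (s j) (D j) (hD j) p hp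
      (h4 j (Finset.mem_univ _)) (fun w hw => ?_) (fun i => h5 i (Finset.mem_univ _)) (fun _ => l0)
      (fun i => h6 i (Finset.mem_univ _)) u hu
    have h8 := hΔs w (by
      simp only [aeval_rename]
      exact hw) p hp h3
    simp only [eval_rename] at h8
    exact h8

theorem global_claim [DecidableEq ι] {X : Set (PP K ι)} (hX : IsIntegralVariety X) (n k m : ℕ) (hkm : k ≤ m)
    (hm : 1 ≤ m) (hn : zdim X = ((n : ℕ∞) : WithBot ℕ∞)) {δ : MvPolynomial ι K}
    {B : ι → ι → MvPolynomial ι K}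
    (hB : IsB (VI (coneOf X)) (n + 1) δ B)
    (hgp : ∀ h : (VI (coneOf X)).IsPrime, rk K (Set.range (gp (VI (coneOf X)))) = ((n + 1 : ℕ) : ℕ∞))
    (hsec : zdim (secant m X) = (((m * (n + 1) - 1 : ℕ) : ℕ∞) : WithBot ℕ∞)) :
    ∃ G : MvPolynomial (Fin k × ι) K, G ∉ VI (CM (Fin k) X) ∧
      ∀ a c : Fin k → ι → K, (∀ i, a i ∈ coneOf X) → (∀ i, c i ∈ coneOf X) → ∑ i, a i = ∑ i, c i →
        eval (fun q => a q.1 q.2) G ≠ 0 →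
        ∀ j, c j ≠ 0 ∧ ∀ u : Fin k → PP K ι, (∀ i, a i ∈ (u i).submodule) →
          c j ∈ vspan (contactLocus X (Set.range u)) := by
  haveI : Infinite K := inferInstance
  haveI hP := prime_of_irred hX.2
  haveI hV : (VI (CM (Fin k) X)).IsPrime := CM_prime hP hX.2.1
  let J : Ideal (MvPolynomial ((Fin k ⊕ Fin k) × ι) K) := Ideal.span
    ({F | ∃ i : Fin k, ∃ f ∈ VI (coneOf X), F = rename (fun l => (Sum.inl i, l)) f} ∪
     {F | ∃ i : Fin k, ∃ f ∈ VI (coneOf X), F = rename (fun l => (Sum.inr i, l)) f} ∪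
     {F | ∃ l, F = ∑ i : Fin k, MvPolynomial.X (Sum.inl i, l) - ∑ i : Fin k, MvPolynomial.X (Sum.inr i, l)})
  have hfin : J.minimalPrimes.Finite := Ideal.finite_minimalPrimes_of_isNoetherianRing _ J
  have hloc : ∀ Q ∈ J.minimalPrimes, ∃ G : MvPolynomial (Fin k × ι) K, G ∉ VI (CM (Fin k) X) ∧
      ∀ p : (Fin k ⊕ Fin k) × ι → K, (∀ f ∈ Q, eval p f = 0) →
        eval (fun q => p (Sum.inl q.1, q.2)) G ≠ 0 →
        ∀ j, (fun l => p (Sum.inr j, l)) ≠ 0 ∧ ∀ u : Fin k → PP K ι,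
          (∀ i, (fun l => p (Sum.inl i, l)) ∈ (u i).submodule) →
          (fun l => p (Sum.inr j, l)) ∈ vspan (contactLocus X (Set.range u)) := by
    intro Q hQ
    have hJQ : J ≤ Q := hQ.1.2
    refine local_claim hX n k m hkm hm hn hB hgp hsec Q hQ.1.1 (fun i f hf => ?_) (fun i f hf => ?_)
      (fun l => ?_)
    · exact hJQ (Ideal.subset_span (Or.inl (Or.inl ⟨i, f, hf, rfl⟩)))
    · exact hJQ (Ideal.subset_span (Or.inl (Or.inr ⟨i, f, hf, rfl⟩)))
    · exact hJQ (Ideal.subset_span (Or.inr ⟨l, rfl⟩))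
  choose! G hG1 hG2 using hloc
  refine ⟨∏ Q ∈ hfin.toFinset, G Q, fun h => ?_, fun a c ha hc hac hGa j => ?_⟩
  · obtain ⟨Q, hQ, h⟩ := (Ideal.IsPrime.prod_mem_iff (hp := hV)).1 h
    exact hG1 Q (hfin.mem_toFinset.1 hQ) h
  · let p : (Fin k ⊕ Fin k) × ι → K := fun q => Sum.elim a c q.1 q.2
    haveI hk : (RingHom.ker (eval p)).IsPrime := RingHom.ker_isPrime _
    have hJ : J ≤ RingHom.ker (eval p) := by
      refine Ideal.span_le.2 ?_
      rintro F ((⟨i, f, hf, rfl⟩ | ⟨i, f, hf, rfl⟩) | ⟨l, rfl⟩)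
      · rw [SetLike.mem_coe, RingHom.mem_ker, eval_rename]
        exact hf _ (ha i)
      · rw [SetLike.mem_coe, RingHom.mem_ker, eval_rename]
        exact hf _ (hc i)
      · rw [SetLike.mem_coe, RingHom.mem_ker]
        simp only [map_sub, map_sum, eval_X, p, Sum.elim_inl, Sum.elim_inr]
        have := congrFun hac l
        rw [Finset.sum_apply, Finset.sum_apply] at this
        rw [this, sub_self]
    obtain ⟨Q, hQ, hQk⟩ := Ideal.exists_minimalPrimes_le hJ
    rw [map_prod, Finset.prod_ne_zero_iff] at hGa
    exact hG2 Q hQ p (fun f hf => hQk hf) (hGa Q (hfin.mem_toFinset.2 hQ)) j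

end Local

section Final
variable {K : Type*} [Field K] {ι : Type*} [Fintype ι]

/-- the block weight -/
def bw (k : ℕ) (ι : Type*) : Fin k × ι → (Fin k →₀ ℕ) := fun p => Finsupp.single p.1 1

/-- rescaling the blocks of `a` by independent parameters -/
def scaleHom {k : ℕ} (a : Fin k × ι → K) : MvPolynomial (Fin k × ι) K →ₐ[K] MvPolynomial (Fin k) K :=
  aeval (fun p => C (a p) * MvPolynomial.X p.1)

theorem scaleHom_monomial {k : ℕ} (a : Fin k × ι → K) (s : Fin k × ι →₀ ℕ) :
    scaleHom a (monomial s 1) = monomial (Finsupp.weight (bw k ι) s) (eval a (monomial s 1)) := by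
  induction s using Finsupp.induction_linear with
  | zero => simp [scaleHom]
  | add s t hs ht =>
    have : (monomial (s + t) 1 : MvPolynomial (Fin k × ι) K) = monomial s 1 * monomial t 1 := by
      rw [monomial_mul, one_mul]
    rw [this, map_mul, hs, ht, map_mul, map_add, monomial_mul]
  | single p e =>
    rw [← X_pow_eq_monomial, map_pow, map_pow, scaleHom, aeval_X, eval_X, mul_pow, ← map_pow,
      X_pow_eq_monomial, C_mul_monomial, mul_one, Finsupp.weight_single, bw]
    simp

theorem coeff_scaleHom {k : ℕ} (a : Fin k × ι → K) (G : MvPolynomial (Fin k × ι) K) (d : Fin k →₀ ℕ) :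
    coeff d (scaleHom a G) = eval a (weightedHomogeneousComponent (bw k ι) d G) := by
  classical
  induction G using MvPolynomial.induction_on' with
  | monomial s c =>
    have h1 : monomial s c = C c * (monomial s 1 : MvPolynomial (Fin k × ι) K) := by
      rw [C_mul_monomial, mul_one]
    have h2 : (monomial s 1 : MvPolynomial (Fin k × ι) K).IsWeightedHomogeneous (bw k ι) _ :=
      isWeightedHomogeneous_monomial (bw k ι) s 1 rfl
    rw [h1, weightedHomogeneousComponent_C_mul, ← smul_eq_C_mul, map_smul, scaleHom_monomial,
      coeff_smul, coeff_monomial, map_mul, eval_C, smul_eq_mul]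
    congr 1
    split_ifs with h
    · rw [← h, h2.weightedHomogeneousComponent_same]
    · rw [h2.weightedHomogeneousComponent_ne _ (Ne.symm h), map_zero]
  | add p q hp hq => rw [map_add, coeff_add, hp, hq, map_add, map_add]

theorem eval_scaleHom {k : ℕ} (a : Fin k × ι → K) (G : MvPolynomial (Fin k × ι) K) (t : Fin k → K) :
    eval t (scaleHom a G) = eval (fun p => t p.1 * a p) G := by
  have : (aeval t : MvPolynomial (Fin k) K →ₐ[K] K).comp (scaleHom a) = aeval (fun p => t p.1 * a p) := by
    apply MvPolynomial.algHom_ext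
    intro p
    simp [scaleHom, mul_comm]
  exact AlgHom.congr_fun this G

theorem multi_comp [Infinite K] {k : ℕ} (G : MvPolynomial (Fin k × ι) K) :
    ∃ T : Set (Fin k → PP K ι), IsMultiZClosed T ∧ ∀ u : Fin k → PP K ι,
      (∀ a : Fin k → ι → K, (∀ i, a i ∈ (u i).submodule) → eval (fun p => a p.1 p.2) G = 0) ↔ u ∈ T := by
  refine ⟨multiZeroLocus {F | ∃ d, F = weightedHomogeneousComponent (bw k ι) d G}, ⟨_, ?_, rfl⟩, fun u => ?_⟩
  · rintro _ ⟨d, rfl⟩ i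
    refine ⟨d i, fun s hs => ?_⟩
    have h1 := weightedHomogeneousComponent_isWeightedHomogeneous (w := bw k ι) d G hs
    rw [← h1, Finsupp.weight_apply, Finsupp.weight_apply, Finsupp.sum, Finsupp.sum, Finsupp.finset_sum_apply]
    refine Finset.sum_congr rfl fun p _ => ?_
    simp [bw, Finsupp.single_apply]
  constructor
  · rintro h _ ⟨d, rfl⟩ a ha
    have h0 : scaleHom (fun p : Fin k × ι => a p.1 p.2) G = 0 := by
      apply MvPolynomial.funext
      intro t
      rw [eval_scaleHom, map_zero]
      exact h (fun i => t i • a i) fun i => (u i).submodule.smul_mem _ (ha i)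
    rw [← coeff_scaleHom, h0, coeff_zero]
  · intro h a ha
    have h0 : scaleHom (fun p : Fin k × ι => a p.1 p.2) G = 0 := by
      ext d
      rw [coeff_scaleHom, coeff_zero]
      exact h _ ⟨d, rfl⟩ a ha
    have := eval_scaleHom (fun p : Fin k × ι => a p.1 p.2) G (fun _ => 1)
    rw [h0, map_zero] at this
    simpa using this.symm

theorem smooth_exists [Infinite K] {X : Set (PP K ι)} (hX : IsZClosed X) (n k : ℕ)
    (hn : zdim X = ((n : ℕ∞) : WithBot ℕ∞)) (hwd : WeaklyDefective X k) :
    (∃ x, IsSmoothPoint X x) ∧ 1 ≤ n := by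
  obtain ⟨T, _, ⟨u, hu, huT⟩, h⟩ := hwd
  have h0 : 0 < zdim (contactLocus X (Set.range u)) := h u hu huT
  constructor
  · by_contra hcon
    push Not at hcon
    have hE : IsZClosed (zeroLocus ({1} : Set (MvPolynomial ι K))) := isZClosed_zeroLocus _
    have h1 : contactLocus X (Set.range u) ⊆ zeroLocus ({1} : Set (MvPolynomial ι K)) := by
      refine zclosure_subset hE ?_
      refine Set.iUnion₂_subset fun C hC x hx => ?_
      exact absurd (hC.1.2.1 hx).1 (hcon x)
    have h2 := zclosure_subset hE h1
    have h3 : Nonempty {Y : Set (PP K ι) // IsZClosed Y ∧ IsZIrreducible Y ∧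
        Y ⊆ zclosure (contactLocus X (Set.range u))} := by
      by_contra hne
      rw [not_nonempty_iff] at hne
      have h4 : zdim (contactLocus X (Set.range u)) = ⊥ := Order.krullDim_eq_bot
      rw [h4] at h0
      exact absurd h0 (by simp)
    obtain ⟨Y, _, ⟨⟨y, hy⟩, _⟩, hY⟩ := h3
    have := h2 (hY hy) 1 rfl 0 (Submodule.zero_mem _)
    simp at this
  · have h1 : contactLocus X (Set.range u) ⊆ X := by
      refine zclosure_subset hX ?_
      refine Set.iUnion₂_subset fun C hC x hx => ?_
      exact (hC.1.2.1 hx).1.1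
    have h2 := h0.trans_le (zdim_mono (h1.trans (subset_zclosure X)))
    rw [hn] at h2
    have h3 : (0 : ℕ∞) < (n : ℕ∞) := by exact_mod_cast h2
    exact_mod_cast h3

theorem main_aux [IsAlgClosed K] [CharZero K] (n k : ℕ)
    (X : Set (PP K ι)) (hX : IsIntegralVariety X)
    (hXdim : zdim X = ((n : ℕ∞) : WithBot ℕ∞)) (hk : 1 ≤ k)
    (hwd : WeaklyDefective X k)
    (hsec : zdim (secant (k + n - 1) X) =
      ((((k + n - 1) * (n + 1) - 1 : ℕ) : ℕ∞) : WithBot ℕ∞)) :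
    HoldsForGeneralTuples X k fun u =>
      HoldsGenerically (projSpan (Set.range u)) fun Q =>
        ∀ B : Finset (PP K ι), ↑B ⊆ X → B.card = k →
          Q ∈ projSpan (B : Set (PP K ι)) →
          (B : Set (PP K ι)) ⊆ projSpan (contactLocus X (Set.range u)) := by
  classical
  haveI : Infinite K := inferInstance
  haveI hP := prime_of_irred hX.2
  obtain ⟨⟨x0, hx0⟩, hn1⟩ := smooth_exists hX.1 n k hXdim hwd
  obtain ⟨hrk, hfr⟩ := rk_gp n hXdim x0 hx0
  obtain ⟨δ, B, hδ, hcol, hrow, htr⟩ := exists_B (VI (coneOf X))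
  rw [hfr] at htr
  have hB : IsB (VI (coneOf X)) (n + 1) δ B := ⟨hδ, hcol, hrow, htr⟩
  obtain ⟨G, hGV, hG⟩ := global_claim hX n k (k + n - 1) (by omega) (by omega) hXdim hB (fun _ => hrk) hsec
  clear hsec hwd hB
  obtain ⟨T, hT, hTu⟩ := multi_comp G
  refine ⟨T, hT, ?_, fun u hu huT => ?_⟩
  · rw [mem_VI] at hGV
    push Not at hGV
    obtain ⟨a, ha, haG⟩ := hGV
    choose u hu hau using fun i => mem_coneOf.1 (ha i)
    exact ⟨u, hu, fun h => haG ((hTu u).2 h (fun i l => a (i, l)) hau)⟩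
  · rw [← hTu] at huT
    push Not at huT
    obtain ⟨a, ha, haG⟩ := huT
    have hac : ∀ i, a i ∈ coneOf X := fun i => mem_coneOf.2 ⟨u i, hu i, ha i⟩
    have hind : LinearIndependent K a := by
      rw [Fintype.linearIndependent_iff]
      intro μ hμ
      by_contra hne
      push Not at hne
      obtain ⟨j, hj⟩ := hne
      refine (hG a (fun i => (1 - μ i / μ j) • a i) hac (fun i => smul_mem_coneOf (hac i) _) ?_ haG j).1 ?_
      · simp only [sub_smul, one_smul, Finset.sum_sub_distrib]
        have : ∑ i, (μ i / μ j) • a i = (μ j)⁻¹ • ∑ i, μ i • a i := by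
          rw [Finset.smul_sum]
          exact Finset.sum_congr rfl fun i _ => by rw [smul_smul, div_eq_inv_mul]
        rw [this, hμ, smul_zero, sub_zero]
      · simp only [div_self hj, sub_self, zero_smul]
    obtain ⟨h, hh⟩ := exists_dual a hind
    let H : MvPolynomial ι K := aeval (fun p : Fin k × ι => linPoly (h p.1) * C (a p.1 p.2)) G
    have hH : ∀ q : ι → K, eval q H = eval (fun p => (∑ l, h p.1 l * q l) * a p.1 p.2) G := by
      intro q
      have : (aeval q : MvPolynomial ι K →ₐ[K] K).comp
          (aeval (fun p : Fin k × ι => linPoly (h p.1) * C (a p.1 p.2))) =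
          aeval (fun p => (∑ l, h p.1 l * q l) * a p.1 p.2) := by
        apply MvPolynomial.algHom_ext
        intro p
        have h1 : aeval q (linPoly (h p.1)) = ∑ l, h p.1 l * q l := eval_linPoly _ _
        rw [AlgHom.comp_apply, aeval_X, aeval_X, map_mul, h1]
        simp
      exact AlgHom.congr_fun this G
    have hcoef : ∀ (μ : Fin k → K) i, ∑ l, h i l * (∑ j, μ j • a j) l = μ i := by
      intro μ i
      simp only [Finset.sum_apply, Pi.smul_apply, smul_eq_mul, Finset.mul_sum]
      rw [Finset.sum_comm]
      have : ∀ j, ∑ l, h i l * (μ j * a j l) = μ j * (if i = j then 1 else 0) := fun j => by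
        rw [← hh i j, Finset.mul_sum]
        exact Finset.sum_congr rfl fun l _ => by ring
      simp [this]
    have hau : ∀ i, a i ∈ vspan (Set.range u) := fun i =>
      Submodule.subset_span (mem_coneOf.2 ⟨u i, ⟨i, rfl⟩, ha i⟩)
    have ha0 : ∀ i, a i ≠ 0 := fun i => hind.ne_zero i
    refine ⟨zeroLocus {H}, isZClosed_zeroLocus _, fun hsub => ?_, fun Q hQ B hBX hBk hQB => ?_⟩
    · have hq0 : ∑ i, a i ≠ 0 := fun h0 => by
        have := Fintype.linearIndependent_iff.1 hind (fun _ => 1) (by simpa using h0) ⟨0, hk⟩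
        exact one_ne_zero this
      have h1 : Projectivization.mk K (∑ i, a i) hq0 ∈ projSpan (Set.range u) :=
        (submodule_le_iff hq0 (mem_submodule_mk hq0) _).2 (Submodule.sum_mem _ fun i _ => hau i)
      have h2 := hsub h1 H rfl _ (mem_submodule_mk hq0)
      rw [hH] at h2
      apply haG
      rw [← h2]
      have h3 := hcoef (fun _ => 1)
      simp only [one_smul] at h3
      simp only [h3, one_mul]
    · obtain ⟨hQu, hQH⟩ := hQ
      have hQH' : ∃ q ∈ Q.submodule, eval q H ≠ 0 := by
        by_contra hcon
        push Not at hcon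
        exact hQH fun f hf v hv => by
          rw [Set.mem_singleton_iff.1 hf]; exact hcon v hv
      obtain ⟨q, hq, hqH⟩ := hQH'
      obtain ⟨b, hb, hbq⟩ := vspan_range u (hQu hq)
      have hμ : ∀ i, ∃ μ : K, b i = μ • a i := fun i => by
        obtain ⟨s, hs⟩ := mem_submodule_iff.1 (ha i)
        obtain ⟨t, ht⟩ := mem_submodule_iff.1 (hb i)
        have hs0 : s ≠ 0 := fun h => ha0 i (by rw [hs, h, zero_smul])
        exact ⟨t / s, by rw [ht, hs, smul_smul, div_mul_cancel₀ _ hs0]⟩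
      choose μ hμ using hμ
      have hqμ : q = ∑ i, μ i • a i := by
        rw [← hbq]; exact Finset.sum_congr rfl fun i _ => hμ i
      rw [hH, hqμ] at hqH
      simp only [hcoef] at hqH
      let e := (B.equivFinOfCardEq hBk).symm
      have hr : (B : Set (PP K ι)) = Set.range (fun i => (e i : PP K ι)) := by
        ext x
        constructor
        · intro hx
          exact ⟨e.symm ⟨x, hx⟩, by simp⟩
        · rintro ⟨i, rfl⟩
          exact (e i).2
      have hqB := hQB hq
      rw [hr] at hqB
      obtain ⟨c, hc, hcq⟩ := vspan_range _ hqB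
      have key := hG (fun i => μ i • a i) c (fun i => smul_mem_coneOf (hac i) _)
        (fun i => mem_coneOf.2 ⟨_, hBX (e i).2, hc i⟩) (by rw [hcq, hqμ]) hqH
      rw [hr]
      rintro _ ⟨i, rfl⟩
      exact (submodule_le_iff (key i).1 (hc i) _).2
        ((key i).2 u fun i => (u i).submodule.smul_mem _ (ha i))

end Final

end Helpers

/-- **Lemma (gamma).**  Let `X ⊆ ℙ^r` be an integral non-degenerate variety of
dimension `n` (char `0`), weakly `k`-defective, with
`dim σ_{k+n-1}(X) = (k+n-1)(n+1) - 1 < r`.  Let `A` be a general set of `k` points of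
`X` and `Γ_k(A)` the tangential `k`-contact locus.  Then for a general `Q ∈ ⟨A⟩`,
every subset `B ⊆ X` of cardinality `k` with `Q ∈ ⟨B⟩` is contained in `⟨Γ_k(A)⟩`. -/
theorem statement3 {K : Type*} [Field K] [IsAlgClosed K] [CharZero K]
    {ι : Type*} [Fintype ι] (r n k : ℕ) (hι : Fintype.card ι = r + 1)
    (X : Set (PP K ι)) (hX : IsIntegralVariety X) (hXnd : Nondegenerate X)
    (hXdim : zdim X = ((n : ℕ∞) : WithBot ℕ∞)) (hk : 1 ≤ k)
    (hwd : WeaklyDefective X k)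
    (hsec : zdim (secant (k + n - 1) X) =
      ((((k + n - 1) * (n + 1) - 1 : ℕ) : ℕ∞) : WithBot ℕ∞))
    (hlt : (k + n - 1) * (n + 1) - 1 < r) :
    HoldsForGeneralTuples X k fun u =>
      HoldsGenerically (projSpan (Set.range u)) fun Q =>
        ∀ B : Finset (PP K ι), ↑B ⊆ X → B.card = k →
          Q ∈ projSpan (B : Set (PP K ι)) →
          (B : Set (PP K ι)) ⊆ projSpan (contactLocus X (Set.range u)) := by
  exact main_aux n k X hX hXdim hk hwd hsec

end ContactLoci
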